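/- arXiv:1703.10783 — 2 statements merged into one kernel-verified Lean document; each statement's English description precedes it below -/
import Mathlib

section
/- Let f : ℝⁿ → ℝ, α ∈ (0,1), x ∈ ℝⁿ and r > 0. Then |f(x) − (f)_{B(x,r)}| ≲ r^α · M((−Δ)^{α/2} f)(x), where (f)_{B(x,r)} denotes the average of f over the ball B(x,r) and M is the Hardy–Littlewood maximal function. -/
open MeasureTheory

/-- The (centered) Hardy–Littlewood maximal function on `ℝⁿ`. -/
noncomputable def maxFn {n : ℕ} (g : EuclideanSpace ℝ (Fin n) → ℝ)
    (x : EuclideanSpace ℝ (Fin n)) : ℝ :=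
  ⨆ r : {r : ℝ // 0 < r}, ⨍ z in Metric.ball x r.1, |g z|

/-- The fractional Laplacian `(-Δ)^{α/2}` on `ℝⁿ`. -/
noncomputable def fracLap {n : ℕ} (α : ℝ) (f : EuclideanSpace ℝ (Fin n) → ℝ)
    (x : EuclideanSpace ℝ (Fin n)) : ℝ :=
  ∫ y, (f x - f y) / ‖x - y‖ ^ ((n : ℝ) + α)


/-- Summing over geometric annuli: if `μ (ball x s) ≤ K s ^ d` for all `s`, the integral of
`dist · x ^ (-p)` over a set covered by the annuli `R q ^ k ≤ dist · x ≤ 2 R q ^ k` is controlled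
by a geometric series. -/
lemma lintegral_dist_rpow_le_of_annuli {X : Type*} [PseudoMetricSpace X] [MeasurableSpace X]
    [OpensMeasurableSpace X] {d p q : ℝ} (hp : 0 < p) (hq : 0 < q)
    (hq1 : q ^ (d - p) < 1) (μ : Measure X) (x : X) (K : ENNReal)
    (hμ : ∀ s : ℝ, 0 < s → μ (Metric.ball x s) ≤ K * ENNReal.ofReal (s ^ d)) {R : ℝ} (hR : 0 < R)
    (S : Set X) (hS : ∀ y ∈ S, 0 < dist y x →
      ∃ k : ℕ, R * q ^ k ≤ dist y x ∧ dist y x ≤ 2 * (R * q ^ k)) :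
    ∫⁻ y in S, ENNReal.ofReal (dist y x ^ (-p)) ∂μ
      ≤ ENNReal.ofReal (4 ^ d / (1 - q ^ (d - p))) * K * ENNReal.ofReal (R ^ (d - p)) := by
  set A : ℕ → Set X := fun k => {y | R * q ^ k ≤ dist y x ∧ dist y x ≤ 2 * (R * q ^ k)} with hA
  have hmeasdist : Measurable fun y : X => dist y x := (continuous_id.dist continuous_const).measurable
  have hAk : ∀ k, ∫⁻ y in A k, ENNReal.ofReal (dist y x ^ (-p)) ∂μ
      ≤ K * ENNReal.ofReal (4 ^ d * R ^ (d - p)) * ENNReal.ofReal (q ^ (d - p)) ^ k := by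
    intro k
    set ρ := R * q ^ k with hρ
    have hρ0 : 0 < ρ := by positivity
    have hmeas : MeasurableSet (A k) :=
      (measurableSet_le measurable_const hmeasdist).inter
        (measurableSet_le hmeasdist measurable_const)
    calc ∫⁻ y in A k, ENNReal.ofReal (dist y x ^ (-p)) ∂μ
        ≤ ∫⁻ y in A k, ENNReal.ofReal (ρ ^ (-p)) ∂μ := by
          refine setLIntegral_mono' hmeas fun y hy => ENNReal.ofReal_le_ofReal ?_
          exact Real.rpow_le_rpow_of_nonpos hρ0 hy.1 (by linarith)
      _ = ENNReal.ofReal (ρ ^ (-p)) * μ (A k) := by simp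
      _ ≤ ENNReal.ofReal (ρ ^ (-p)) * (K * ENNReal.ofReal ((4 * ρ) ^ d)) := by
          gcongr
          refine (measure_mono fun y hy => ?_).trans (hμ (4 * ρ) (by positivity))
          rw [Metric.mem_ball]
          have := hy.2
          linarith
      _ = K * (ENNReal.ofReal (ρ ^ (-p)) * ENNReal.ofReal ((4 * ρ) ^ d)) := by ring
      _ = K * ENNReal.ofReal (4 ^ d * R ^ (d - p)) * ENNReal.ofReal (q ^ (d - p)) ^ k := by
          rw [mul_assoc, ← ENNReal.ofReal_pow (by positivity), ← ENNReal.ofReal_mul (by positivity),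
            ← ENNReal.ofReal_mul (by positivity)]
          congr 2
          have h1 : (q ^ (d - p)) ^ k = (q ^ k) ^ (d - p) := by
            rw [← Real.rpow_natCast, ← Real.rpow_natCast, ← Real.rpow_mul hq.le,
              ← Real.rpow_mul hq.le, mul_comm]
          rw [h1, mul_assoc, ← Real.mul_rpow hR.le (by positivity), ← hρ,
            Real.mul_rpow (by norm_num) hρ0.le, sub_eq_add_neg, Real.rpow_add hρ0]
          ring
  have hcov : ∫⁻ y in S, ENNReal.ofReal (dist y x ^ (-p)) ∂μ
      ≤ ∫⁻ y in ⋃ k, A k, ENNReal.ofReal (dist y x ^ (-p)) ∂μ := by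
    have hz : MeasurableSet {y : X | 0 < dist y x} := measurableSet_lt measurable_const hmeasdist
    calc ∫⁻ y in S, ENNReal.ofReal (dist y x ^ (-p)) ∂μ
        = ∫⁻ y in S, {y : X | 0 < dist y x}.indicator
            (fun y => ENNReal.ofReal (dist y x ^ (-p))) y ∂μ := by
          congr 1
          ext y
          by_cases h : 0 < dist y x
          · rw [Set.indicator_of_mem (by exact h)]
          · rw [Set.indicator_of_notMem (by exact h), le_antisymm (not_lt.mp h) dist_nonneg,
              Real.zero_rpow (by linarith), ENNReal.ofReal_zero]
      _ = ∫⁻ y in {y : X | 0 < dist y x} ∩ S, ENNReal.ofReal (dist y x ^ (-p)) ∂μ := by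
          rw [lintegral_indicator hz, Measure.restrict_restrict hz]
      _ ≤ _ := by
          refine lintegral_mono_set fun y hy => ?_
          obtain ⟨k, hk⟩ := hS y hy.2 hy.1
          exact Set.mem_iUnion.2 ⟨k, hk⟩
  refine hcov.trans ((lintegral_iUnion_le _ _).trans ((ENNReal.tsum_le_tsum hAk).trans ?_))
  have hq0 : 0 < q ^ (d - p) := by positivity
  rw [ENNReal.tsum_mul_left, ENNReal.tsum_geometric, ← ENNReal.ofReal_one,
    ← ENNReal.ofReal_sub _ hq0.le, ← ENNReal.ofReal_inv_of_pos (by linarith), div_eq_mul_inv,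
    ENNReal.ofReal_mul (by positivity), ENNReal.ofReal_mul (by positivity)]
  apply le_of_eq
  ring

lemma exists_setLIntegral_ball_dist_rpow_le {d p : ℝ} (hp : 0 < p) (hpd : p < d) :
    ∃ C : ℝ, 0 < C ∧ ∀ {X : Type} [PseudoMetricSpace X] [MeasurableSpace X]
      [OpensMeasurableSpace X] (μ : Measure X) (x : X) (K : ENNReal),
      (∀ s : ℝ, 0 < s → μ (Metric.ball x s) ≤ K * ENNReal.ofReal (s ^ d)) → ∀ R : ℝ, 0 < R →
      ∫⁻ y in Metric.ball x R, ENNReal.ofReal (dist y x ^ (-p)) ∂μ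
        ≤ ENNReal.ofReal C * K * ENNReal.ofReal (R ^ (d - p)) := by
  have hq1 : (1 / 2 : ℝ) ^ (d - p) < 1 :=
    Real.rpow_lt_one (by norm_num) (by norm_num) (by linarith)
  refine ⟨4 ^ d / (1 - (1 / 2 : ℝ) ^ (d - p)) * (1 / 2 : ℝ) ^ (d - p), ?_, ?_⟩
  · have : 0 < 1 - (1 / 2 : ℝ) ^ (d - p) := by linarith
    positivity
  intro X _ _ _ μ x K hμ R hR
  refine (lintegral_dist_rpow_le_of_annuli hp (q := 1 / 2) (by norm_num) hq1 μ x K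
    hμ (R := R * (1 / 2)) (by positivity) _ fun y hy h0 => ?_).trans (le_of_eq ?_)
  · rw [Metric.mem_ball] at hy
    obtain ⟨k, hk1, hk2⟩ := exists_nat_pow_near_of_lt_one (x := dist y x / R) (y := (1 / 2 : ℝ))
      (by positivity) ((div_le_one hR).2 hy.le) (by norm_num) (by norm_num)
    rw [lt_div_iff₀ hR] at hk1
    rw [div_le_iff₀ hR] at hk2
    refine ⟨k, ?_, ?_⟩
    · rw [pow_succ] at hk1
      linarith
    · linarith
  · have : 0 < 1 - (1 / 2 : ℝ) ^ (d - p) := by linarith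
    rw [Real.mul_rpow hR.le (by norm_num), ENNReal.ofReal_mul (by positivity),
      ENNReal.ofReal_mul (p := _ / _) (by positivity)]
    ring

lemma exists_setLIntegral_compl_ball_dist_rpow_le {d p : ℝ} (hd : 0 < d) (hpd : d < p) :
    ∃ C : ℝ, 0 < C ∧ ∀ {X : Type} [PseudoMetricSpace X] [MeasurableSpace X]
      [OpensMeasurableSpace X] (μ : Measure X) (x : X) (K : ENNReal),
      (∀ s : ℝ, 0 < s → μ (Metric.ball x s) ≤ K * ENNReal.ofReal (s ^ d)) → ∀ R : ℝ, 0 < R →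
      ∫⁻ y in (Metric.ball x R)ᶜ, ENNReal.ofReal (dist y x ^ (-p)) ∂μ
        ≤ ENNReal.ofReal C * K * ENNReal.ofReal (R ^ (d - p)) := by
  have hq1 : (2 : ℝ) ^ (d - p) < 1 :=
    Real.rpow_lt_one_of_one_lt_of_neg (by norm_num) (by linarith)
  refine ⟨4 ^ d / (1 - (2 : ℝ) ^ (d - p)), ?_, ?_⟩
  · have : 0 < 1 - (2 : ℝ) ^ (d - p) := by linarith
    positivity
  intro X _ _ _ μ x K hμ R hR
  refine lintegral_dist_rpow_le_of_annuli (hd.trans hpd) (q := 2) (by norm_num) hq1 μ x K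
    hμ hR _ fun y hy h0 => ?_
  rw [Set.mem_compl_iff, Metric.mem_ball, not_lt] at hy
  obtain ⟨k, hk1, hk2⟩ := exists_nat_pow_near (x := dist y x / R) (y := (2 : ℝ))
    ((one_le_div hR).2 hy) (by norm_num)
  rw [div_lt_iff₀ hR] at hk2
  rw [le_div_iff₀ hR] at hk1
  refine ⟨k, by linarith, ?_⟩
  rw [pow_succ] at hk2
  linarith

lemma volume_ball_eq_ofReal_rpow_mul {n : ℕ} (x : EuclideanSpace ℝ (Fin n)) {s : ℝ} (hs : 0 < s) :
    volume (Metric.ball x s) = volume (Metric.ball (0 : EuclideanSpace ℝ (Fin n)) 1) *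
      ENNReal.ofReal (s ^ (n : ℝ)) := by
  rw [Measure.addHaar_ball_of_pos _ _ hs, finrank_euclideanSpace_fin, Real.rpow_natCast, mul_comm]

lemma exists_lintegral_abs_sub_div_le {n : ℕ} (hn : 0 < n) {α : ℝ} (hα : α ∈ Set.Ioo (0 : ℝ) 1)
    {f : EuclideanSpace ℝ (Fin n) → ℝ} {L : NNReal} (hL : LipschitzWith L f) {B : ℝ}
    (hB : ∀ y, |f y| ≤ B) :
    ∃ D : ℝ, 0 ≤ D ∧ ∀ y,
      ∫⁻ w, ENNReal.ofReal (|f y - f w| / ‖y - w‖ ^ ((n : ℝ) + α)) ≤ ENNReal.ofReal D := by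
  have hn1 : (1 : ℝ) ≤ n := by exact_mod_cast hn
  obtain ⟨C₁, hC₁, h₁⟩ := exists_setLIntegral_ball_dist_rpow_le (d := n) (p := n + α - 1)
    (by linarith [hα.1]) (by linarith [hα.2])
  obtain ⟨C₂, hC₂, h₂⟩ := exists_setLIntegral_compl_ball_dist_rpow_le (d := n) (p := n + α)
    (by linarith) (by linarith [hα.1])
  have hB0 : 0 ≤ B := (abs_nonneg _).trans (hB 0)
  set v := volume (Metric.ball (0 : EuclideanSpace ℝ (Fin n)) 1) with hv
  have hvtop : v ≠ ⊤ := measure_ball_lt_top.ne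
  refine ⟨L * (C₁ * v.toReal) + 2 * B * (C₂ * v.toReal), by positivity, fun y => ?_⟩
  have hball : ∀ s : ℝ, 0 < s → volume (Metric.ball y s) ≤ v * ENNReal.ofReal (s ^ (n : ℝ)) :=
    fun s hs => (volume_ball_eq_ofReal_rpow_mul y hs).le
  have e₁ := h₁ volume y v hball 1 one_pos
  have e₂ := h₂ volume y v hball 1 one_pos
  rw [Real.one_rpow, ENNReal.ofReal_one, mul_one, ← ENNReal.ofReal_toReal hvtop,
    ← ENNReal.ofReal_mul hC₁.le] at e₁
  rw [Real.one_rpow, ENNReal.ofReal_one, mul_one, ← ENNReal.ofReal_toReal hvtop,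
    ← ENNReal.ofReal_mul hC₂.le] at e₂
  rw [← lintegral_add_compl _ (Metric.isOpen_ball (x := y) (ε := 1)).measurableSet,
    ENNReal.ofReal_add (by positivity) (by positivity)]
  gcongr
  · rw [ENNReal.ofReal_mul (by positivity)]
    refine le_trans ?_ (mul_le_mul_right e₁ _)
    rw [← lintegral_const_mul' _ _ ENNReal.ofReal_ne_top]
    refine lintegral_mono fun w => ?_
    rw [← ENNReal.ofReal_mul (by positivity)]
    apply ENNReal.ofReal_le_ofReal
    have hle := hL.dist_le_mul y w
    rw [Real.dist_eq, dist_eq_norm] at hle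
    rw [dist_comm, dist_eq_norm]
    rcases eq_or_lt_of_le (norm_nonneg (y - w)) with h0 | h0
    · rw [← h0, mul_zero] at hle
      rw [le_antisymm hle (abs_nonneg _), zero_div]
      positivity
    · rw [div_eq_mul_inv, ← Real.rpow_neg h0.le,
        show -((n : ℝ) + α - 1) = 1 + -((n : ℝ) + α) by ring, Real.rpow_add h0, Real.rpow_one,
        ← mul_assoc]
      gcongr
  · rw [ENNReal.ofReal_mul (by positivity)]
    refine le_trans ?_ (mul_le_mul_right e₂ _)
    rw [← lintegral_const_mul' _ _ ENNReal.ofReal_ne_top]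
    refine lintegral_mono fun w => ?_
    rw [← ENNReal.ofReal_mul (by positivity)]
    apply ENNReal.ofReal_le_ofReal
    rw [dist_comm, dist_eq_norm, Real.rpow_neg (norm_nonneg _), div_eq_mul_inv]
    gcongr
    calc |f y - f w| ≤ |f y| + |f w| := abs_sub _ _
      _ ≤ 2 * B := by linarith [hB y, hB w]

lemma exists_lintegral_abs_sub_div_le_norm_rpow {n : ℕ} {α : ℝ} (hα : 0 < (n : ℝ) + α)
    {f : EuclideanSpace ℝ (Fin n) → ℝ} {B : ℝ} (hB : ∀ y, |f y| ≤ B) {R : ℝ} (hR : 0 < R)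
    (hf : ∀ y, R ≤ ‖y‖ → f y = 0) :
    ∃ D : ℝ, 0 ≤ D ∧ ∀ y, 2 * R ≤ ‖y‖ →
      ∫⁻ w, ENNReal.ofReal (|f y - f w| / ‖y - w‖ ^ ((n : ℝ) + α))
        ≤ ENNReal.ofReal (D * ‖y‖ ^ (-((n : ℝ) + α))) := by
  have hB0 : 0 ≤ B := (abs_nonneg _).trans (hB 0)
  set V := volume (Metric.ball (0 : EuclideanSpace ℝ (Fin n)) R) with hV
  have hVtop : V ≠ ⊤ := measure_ball_lt_top.ne
  refine ⟨B * 2 ^ ((n : ℝ) + α) * V.toReal, by positivity, fun y hy => ?_⟩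
  have hy0 : 0 < ‖y‖ := by linarith
  calc ∫⁻ w, ENNReal.ofReal (|f y - f w| / ‖y - w‖ ^ ((n : ℝ) + α))
      ≤ ∫⁻ w, (Metric.ball (0 : EuclideanSpace ℝ (Fin n)) R).indicator
          (fun _ => ENNReal.ofReal (B * 2 ^ ((n : ℝ) + α) * ‖y‖ ^ (-((n : ℝ) + α)))) w := by
        refine lintegral_mono fun w => ?_
        by_cases hw : w ∈ Metric.ball (0 : EuclideanSpace ℝ (Fin n)) R
        · rw [Set.indicator_of_mem hw]
          rw [mem_ball_zero_iff] at hw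
          apply ENNReal.ofReal_le_ofReal
          rw [hf y (by linarith), zero_sub, abs_neg, Real.rpow_neg hy0.le, mul_assoc,
            ← div_eq_mul_inv, div_eq_mul_inv, ← inv_div, ← Real.div_rpow hy0.le (by norm_num)]
          have h2 : ‖y‖ / 2 ≤ ‖y - w‖ := by
            have := norm_sub_norm_le y w
            linarith
          gcongr
          exact hB w
        · rw [mem_ball_zero_iff, not_lt] at hw
          rw [hf y (by linarith), hf w hw]
          simp
    _ = ENNReal.ofReal (B * 2 ^ ((n : ℝ) + α) * ‖y‖ ^ (-((n : ℝ) + α))) * V := by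
        rw [lintegral_indicator Metric.isOpen_ball.measurableSet, setLIntegral_const]
    _ = _ := by
        rw [← ENNReal.ofReal_toReal hVtop, ← ENNReal.ofReal_mul (by positivity)]
        congr 1
        rw [ENNReal.toReal_ofReal ENNReal.toReal_nonneg]
        ring

lemma integrable_riesz_mul_fracLap_kernel {n : ℕ} (hn : 0 < n) {α : ℝ}
    (hα : α ∈ Set.Ioo (0 : ℝ) 1) {f : EuclideanSpace ℝ (Fin n) → ℝ} (hf : ContDiff ℝ (⊤ : ℕ∞) f)
    (hfc : HasCompactSupport f) :
    Integrable (fun p : EuclideanSpace ℝ (Fin n) × EuclideanSpace ℝ (Fin n) =>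
      ‖p.1‖ ^ (-((n : ℝ) - α)) * ((f p.1 - f p.2) / ‖p.1 - p.2‖ ^ ((n : ℝ) + α))) := by
  have hn1 : (1 : ℝ) ≤ n := by exact_mod_cast hn
  have hα0 := hα.1
  have hα1 := hα.2
  obtain ⟨L, hL⟩ := ContDiff.lipschitzWith_of_hasCompactSupport hfc hf (by simp)
  obtain ⟨B, hB⟩ := hfc.exists_bound_of_continuous hf.continuous
  obtain ⟨R₀, hR, hfR⟩ := hfc.exists_pos_le_norm
  obtain ⟨D₁, hD₁, h₁⟩ := exists_lintegral_abs_sub_div_le hn hα hL hB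
  obtain ⟨D₂, hD₂, h₂⟩ := exists_lintegral_abs_sub_div_le_norm_rpow (α := α) (by linarith) hB hR hfR
  obtain ⟨C₁, hC₁, e₁⟩ := exists_setLIntegral_ball_dist_rpow_le (d := n) (p := n - α)
    (by linarith) (by linarith)
  obtain ⟨C₂, hC₂, e₂⟩ := exists_setLIntegral_compl_ball_dist_rpow_le (d := n) (p := 2 * n)
    (by linarith) (by linarith)
  have hball : ∀ s : ℝ, 0 < s → volume (Metric.ball (0 : EuclideanSpace ℝ (Fin n)) s) ≤
      volume (Metric.ball (0 : EuclideanSpace ℝ (Fin n)) 1) * ENNReal.ofReal (s ^ (n : ℝ)) :=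
    fun s hs => (volume_ball_eq_ofReal_rpow_mul _ hs).le
  replace e₁ := (e₁ volume 0 _ hball (2 * R₀) (by positivity)).trans_lt
    (ENNReal.mul_lt_top (ENNReal.mul_lt_top ENNReal.ofReal_lt_top measure_ball_lt_top)
      ENNReal.ofReal_lt_top)
  replace e₂ := (e₂ volume 0 _ hball (2 * R₀) (by positivity)).trans_lt
    (ENNReal.mul_lt_top (ENNReal.mul_lt_top ENNReal.ofReal_lt_top measure_ball_lt_top)
      ENNReal.ofReal_lt_top)
  have hfm : Measurable f := hf.continuous.measurable
  have hmeas : Measurable (fun p : EuclideanSpace ℝ (Fin n) × EuclideanSpace ℝ (Fin n) =>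
      ‖p.1‖ ^ (-((n : ℝ) - α)) * ((f p.1 - f p.2) / ‖p.1 - p.2‖ ^ ((n : ℝ) + α))) := by
    fun_prop
  refine ⟨hmeas.aestronglyMeasurable, ?_⟩
  rw [hasFiniteIntegral_iff_norm, Measure.volume_eq_prod,
    lintegral_prod _ (by fun_prop)]
  have hinner : ∀ y : EuclideanSpace ℝ (Fin n), ∫⁻ w, ENNReal.ofReal
      ‖‖y‖ ^ (-((n : ℝ) - α)) * ((f y - f w) / ‖y - w‖ ^ ((n : ℝ) + α))‖ =
      ENNReal.ofReal (‖y‖ ^ (-((n : ℝ) - α))) *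
        ∫⁻ w, ENNReal.ofReal (|f y - f w| / ‖y - w‖ ^ ((n : ℝ) + α)) := by
    intro y
    rw [← lintegral_const_mul' _ _ ENNReal.ofReal_ne_top]
    congr 1
    ext w
    rw [← ENNReal.ofReal_mul (by positivity), norm_mul, norm_div, Real.norm_eq_abs,
      Real.norm_eq_abs, Real.norm_eq_abs, abs_of_nonneg (by positivity : 0 ≤ ‖y‖ ^ (-((n : ℝ) - α))),
      abs_of_nonneg (by positivity : 0 ≤ ‖y - w‖ ^ ((n : ℝ) + α))]
  simp_rw [hinner]
  rw [← lintegral_add_compl _ (Metric.isOpen_ball (x := (0 : EuclideanSpace ℝ (Fin n)))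
    (ε := 2 * R₀)).measurableSet]
  refine ENNReal.add_lt_top.2 ⟨?_, ?_⟩
  · refine lt_of_le_of_lt ?_ (ENNReal.mul_lt_top (ENNReal.ofReal_lt_top (r := D₁)) e₁)
    rw [← lintegral_const_mul' _ _ ENNReal.ofReal_ne_top]
    refine lintegral_mono fun y => ?_
    simp only [dist_zero_right]
    rw [mul_comm]
    gcongr
    exact h₁ y
  · refine lt_of_le_of_lt ?_ (ENNReal.mul_lt_top (ENNReal.ofReal_lt_top (r := D₂)) e₂)
    rw [← lintegral_const_mul' _ _ ENNReal.ofReal_ne_top]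
    refine setLIntegral_mono' Metric.isOpen_ball.measurableSet.compl fun y hy => ?_
    rw [Set.mem_compl_iff, mem_ball_zero_iff, not_lt] at hy
    have hy0 : 0 < ‖y‖ := by linarith
    refine (mul_le_mul_right (h₂ y hy) _).trans (le_of_eq ?_)
    rw [← ENNReal.ofReal_mul (by positivity), ← ENNReal.ofReal_mul (by positivity),
      dist_zero_right, mul_left_comm, ← Real.rpow_add hy0]
    ring_nf

lemma integrable_exp_neg_mul_norm_sq {n : ℕ} {b : ℝ} (hb : 0 < b) :
    Integrable (fun v : EuclideanSpace ℝ (Fin n) => Real.exp (-b * ‖v‖ ^ 2)) := by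
  refine Integrable.of_integral_ne_zero ?_
  rw [GaussianFourier.integral_rexp_neg_mul_sq_norm hb]
  have := Real.pi_pos
  positivity

/-- The Gaussian mean of `f` at inverse scale `s` (up to the factor `π ^ (n / 2)`). -/
noncomputable def gaussMean {n : ℕ} (f : EuclideanSpace ℝ (Fin n) → ℝ) (s : ℝ) : ℝ :=
  s ^ ((n : ℝ) / 2) * ∫ y, Real.exp (-s * ‖y‖ ^ 2) * f y

lemma gaussMean_eq_integral_comp_smul {n : ℕ} (f : EuclideanSpace ℝ (Fin n) → ℝ) {s : ℝ}
    (hs : 0 < s) :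
    gaussMean f s = ∫ y, Real.exp (-1 * ‖y‖ ^ 2) * f ((Real.sqrt s)⁻¹ • y) := by
  have h := Measure.integral_comp_inv_smul volume
    (fun y : EuclideanSpace ℝ (Fin n) => Real.exp (-s * ‖y‖ ^ 2) * f y) (Real.sqrt s)
  have hs' : 0 < Real.sqrt s := Real.sqrt_pos.2 hs
  rw [finrank_euclideanSpace_fin, abs_of_pos (by positivity), smul_eq_mul] at h
  rw [gaussMean, show s ^ ((n : ℝ) / 2) = Real.sqrt s ^ n by
    rw [Real.sqrt_eq_rpow, ← Real.rpow_natCast, ← Real.rpow_mul hs.le]; ring_nf, ← h]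
  congr 1
  ext y
  rw [norm_smul, norm_inv, Real.norm_of_nonneg hs'.le, mul_pow, inv_pow, Real.sq_sqrt hs.le]
  congr 2
  field_simp

lemma continuousOn_gaussMean {n : ℕ} {f : EuclideanSpace ℝ (Fin n) → ℝ} (hf : Continuous f)
    {B : ℝ} (hB : ∀ y, |f y| ≤ B) : ContinuousOn (gaussMean f) (Set.Ioi 0) := by
  have h : ContinuousOn (fun s : ℝ => ∫ y : EuclideanSpace ℝ (Fin n),
      Real.exp (-1 * ‖y‖ ^ 2) * f ((Real.sqrt s)⁻¹ • y)) (Set.Ioi 0) := by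
    refine continuousOn_of_dominated
      (bound := fun y => Real.exp (-1 * ‖y‖ ^ 2) * B) (fun s _ => ?_) (fun s _ => ?_) ?_ ?_
    · exact (by fun_prop : Continuous fun y : EuclideanSpace ℝ (Fin n) =>
        Real.exp (-1 * ‖y‖ ^ 2) * f ((Real.sqrt s)⁻¹ • y)).aestronglyMeasurable
    · refine Filter.Eventually.of_forall fun y => ?_
      rw [norm_mul, Real.norm_of_nonneg (Real.exp_pos _).le]
      gcongr
      exact hB _
    · exact (integrable_exp_neg_mul_norm_sq one_pos).mul_const B
    · refine Filter.Eventually.of_forall fun y => ?_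
      refine continuousOn_const.mul (hf.comp_continuousOn ?_)
      refine ContinuousOn.smul (ContinuousOn.inv₀ Real.continuous_sqrt.continuousOn
        fun s hs => (Real.sqrt_pos.2 hs).ne') continuousOn_const
  exact h.congr fun s hs => gaussMean_eq_integral_comp_smul f hs

lemma tendsto_gaussMean_atTop {n : ℕ} {f : EuclideanSpace ℝ (Fin n) → ℝ} (hf : Continuous f)
    {B : ℝ} (hB : ∀ y, |f y| ≤ B) :
    Filter.Tendsto (gaussMean f) Filter.atTop (nhds (Real.pi ^ ((n : ℝ) / 2) * f 0)) := by
  have h : Filter.Tendsto (fun s : ℝ => ∫ y : EuclideanSpace ℝ (Fin n),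
      Real.exp (-1 * ‖y‖ ^ 2) * f ((Real.sqrt s)⁻¹ • y)) Filter.atTop
      (nhds (∫ y : EuclideanSpace ℝ (Fin n), Real.exp (-1 * ‖y‖ ^ 2) * f 0)) := by
    refine tendsto_integral_filter_of_dominated_convergence
      (fun y => Real.exp (-1 * ‖y‖ ^ 2) * B) (Filter.Eventually.of_forall fun s => ?_)
      (Filter.Eventually.of_forall fun s => ?_) ?_ ?_
    · exact (by fun_prop : Continuous fun y : EuclideanSpace ℝ (Fin n) =>
        Real.exp (-1 * ‖y‖ ^ 2) * f ((Real.sqrt s)⁻¹ • y)).aestronglyMeasurable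
    · refine Filter.Eventually.of_forall fun y => ?_
      rw [norm_mul, Real.norm_of_nonneg (Real.exp_pos _).le]
      gcongr
      exact hB _
    · exact (integrable_exp_neg_mul_norm_sq one_pos).mul_const B
    · refine Filter.Eventually.of_forall fun y => ?_
      refine Filter.Tendsto.const_mul _ ?_
      have h0 : Filter.Tendsto (fun s : ℝ => (Real.sqrt s)⁻¹ • y) Filter.atTop
          (nhds ((0 : ℝ) • y)) :=
        (tendsto_inv_atTop_zero.comp Real.tendsto_sqrt_atTop).smul_const y
      rw [zero_smul] at h0
      exact (hf.tendsto 0).comp h0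
  rw [integral_mul_const, GaussianFourier.integral_rexp_neg_mul_sq_norm one_pos, div_one,
    finrank_euclideanSpace_fin] at h
  refine h.congr' ?_
  filter_upwards [Filter.eventually_gt_atTop 0] with s hs
  exact (gaussMean_eq_integral_comp_smul f hs).symm

lemma tendsto_gaussMean_zero {n : ℕ} (hn : 0 < n) {f : EuclideanSpace ℝ (Fin n) → ℝ}
    (hf : Integrable f) :
    Filter.Tendsto (gaussMean f) (nhdsWithin 0 (Set.Ioi 0)) (nhds 0) := by
  have hn' : (0 : ℝ) < (n : ℝ) / 2 := by positivity
  have h0 : Filter.Tendsto (fun s : ℝ => s ^ ((n : ℝ) / 2) * ∫ y, |f y|)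
      (nhdsWithin 0 (Set.Ioi 0)) (nhds 0) := by
    have : ContinuousAt (fun s : ℝ => s ^ ((n : ℝ) / 2) * ∫ y, |f y|) 0 :=
      (Real.continuousAt_rpow_const _ _ (Or.inr hn'.le)).mul_const _
    have h := this.tendsto.mono_left (nhdsWithin_le_nhds (s := Set.Ioi 0))
    rwa [Real.zero_rpow hn'.ne', zero_mul] at h
  refine squeeze_zero_norm' ?_ h0
  filter_upwards [self_mem_nhdsWithin] with s hs
  have hs : 0 < s := hs
  rw [gaussMean, norm_mul, Real.norm_of_nonneg (by positivity : 0 ≤ s ^ ((n : ℝ) / 2))]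
  gcongr
  refine norm_integral_le_of_norm_le hf.abs (Filter.Eventually.of_forall fun y => ?_)
  rw [norm_mul, Real.norm_of_nonneg (Real.exp_pos _).le, Real.norm_eq_abs]
  refine mul_le_of_le_one_left (abs_nonneg _) (Real.exp_le_one_iff.2 ?_)
  have : 0 ≤ s * ‖y‖ ^ 2 := by positivity
  linarith

lemma norm_sq_add_mul_norm_sub_sq {V : Type*} [NormedAddCommGroup V] [InnerProductSpace ℝ V]
    {τ : ℝ} (hτ : 0 < τ) (y w : V) :
    ‖y‖ ^ 2 + τ * ‖y - w‖ ^ 2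
      = (1 + τ) * ‖y - (τ / (1 + τ)) • w‖ ^ 2 + τ / (1 + τ) * ‖w‖ ^ 2 := by
  rw [norm_sub_sq_real, norm_sub_sq_real, norm_smul, real_inner_smul_right, mul_pow,
    Real.norm_eq_abs, sq_abs]
  field_simp
  ring

lemma integral_gaussian_pair_mul_sub {n : ℕ} {f : EuclideanSpace ℝ (Fin n) → ℝ}
    (hf : Continuous f) (hfi : Integrable f) {s τ : ℝ} (hs : 0 < s) (hτ : 0 < τ) :
    ∫ p : EuclideanSpace ℝ (Fin n) × EuclideanSpace ℝ (Fin n),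
      Real.exp (-(s * (‖p.1‖ ^ 2 + τ * ‖p.1 - p.2‖ ^ 2))) * (f p.1 - f p.2)
      = Real.pi ^ ((n : ℝ) / 2) * s ^ (-(n : ℝ)) * τ ^ (-((n : ℝ) / 2)) *
        (gaussMean f s - gaussMean f (τ / (1 + τ) * s)) := by
  have hpi := Real.pi_pos
  have hsτ : 0 < s * τ := by positivity
  have hs1 : 0 < s * (1 + τ) := by positivity
  have hslice : ∀ y w : EuclideanSpace ℝ (Fin n),
      Real.exp (-(s * (‖y‖ ^ 2 + τ * ‖y - w‖ ^ 2)))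
        = Real.exp (-s * ‖y‖ ^ 2) * Real.exp (-(s * τ) * ‖y - w‖ ^ 2) := by
    intro y w
    rw [← Real.exp_add]
    ring_nf
  have hslice' : ∀ y w : EuclideanSpace ℝ (Fin n),
      Real.exp (-(s * (‖y‖ ^ 2 + τ * ‖y - w‖ ^ 2)))
        = Real.exp (-(s * (1 + τ)) * ‖y - (τ / (1 + τ)) • w‖ ^ 2) *
          Real.exp (-(τ / (1 + τ) * s) * ‖w‖ ^ 2) := by
    intro y w
    rw [norm_sq_add_mul_norm_sub_sq hτ, ← Real.exp_add]
    ring_nf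
  have hbdd : Integrable (fun y => Real.exp (-s * ‖y‖ ^ 2) * f y) := by
    refine hfi.norm.mono' (by fun_prop) (Filter.Eventually.of_forall fun y => ?_)
    rw [norm_mul, Real.norm_of_nonneg (Real.exp_pos _).le]
    refine mul_le_of_le_one_left (norm_nonneg _) (Real.exp_le_one_iff.2 ?_)
    have : 0 ≤ s * ‖y‖ ^ 2 := by positivity
    linarith
  have hcont₁ : Continuous fun p : EuclideanSpace ℝ (Fin n) × EuclideanSpace ℝ (Fin n) =>
      Real.exp (-(s * (‖p.1‖ ^ 2 + τ * ‖p.1 - p.2‖ ^ 2))) * f p.1 := by fun_prop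
  have hcont₂ : Continuous fun p : EuclideanSpace ℝ (Fin n) × EuclideanSpace ℝ (Fin n) =>
      Real.exp (-(s * (‖p.1‖ ^ 2 + τ * ‖p.1 - p.2‖ ^ 2))) * f p.2 := by fun_prop
  have hshift : ∀ y : EuclideanSpace ℝ (Fin n),
      ∫ w, Real.exp (-(s * τ) * ‖y - w‖ ^ 2) = (Real.pi / (s * τ)) ^ ((n : ℝ) / 2) := by
    intro y
    rw [integral_sub_left_eq_self (fun w : EuclideanSpace ℝ (Fin n) =>
      Real.exp (-(s * τ) * ‖w‖ ^ 2)) volume y,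
      GaussianFourier.integral_rexp_neg_mul_sq_norm hsτ, finrank_euclideanSpace_fin]
  have h₁ : Integrable (fun p : EuclideanSpace ℝ (Fin n) × EuclideanSpace ℝ (Fin n) =>
      Real.exp (-(s * (‖p.1‖ ^ 2 + τ * ‖p.1 - p.2‖ ^ 2))) * f p.1) := by
    rw [Measure.volume_eq_prod, integrable_prod_iff hcont₁.aestronglyMeasurable]
    refine ⟨Filter.Eventually.of_forall fun y => ?_, ?_⟩
    · simp only [hslice]
      exact (((integrable_exp_neg_mul_norm_sq hsτ).comp_sub_left y).const_mul _).mul_const _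
    · simp only [hslice, norm_mul, Real.norm_of_nonneg (Real.exp_pos _).le]
      simp only [integral_mul_const, integral_const_mul, hshift]
      have := (hbdd.norm).mul_const ((Real.pi / (s * τ)) ^ ((n : ℝ) / 2))
      refine this.congr (Filter.Eventually.of_forall fun y => ?_)
      simp only [norm_mul, Real.norm_of_nonneg (Real.exp_pos _).le]
      ring
  have h₂ : Integrable (fun p : EuclideanSpace ℝ (Fin n) × EuclideanSpace ℝ (Fin n) =>
      Real.exp (-(s * (‖p.1‖ ^ 2 + τ * ‖p.1 - p.2‖ ^ 2))) * f p.2) := by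
    refine ((integrable_exp_neg_mul_norm_sq (n := n) hs).mul_prod hfi).mono
      hcont₂.aestronglyMeasurable (Filter.Eventually.of_forall fun p => ?_)
    rw [hslice, norm_mul, norm_mul, norm_mul]
    gcongr
    refine mul_le_of_le_one_right (norm_nonneg _) ?_
    rw [Real.norm_of_nonneg (Real.exp_pos _).le, Real.exp_le_one_iff]
    have : 0 ≤ s * τ * ‖p.1 - p.2‖ ^ 2 := by positivity
    linarith
  simp only [mul_sub (Real.exp _)]
  rw [integral_sub h₁ h₂, Measure.volume_eq_prod, integral_prod _ h₁, integral_prod_symm _ h₂]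
  have e₁ : ∫ y : EuclideanSpace ℝ (Fin n), ∫ w : EuclideanSpace ℝ (Fin n),
      Real.exp (-(s * (‖y‖ ^ 2 + τ * ‖y - w‖ ^ 2))) * f y
      = (Real.pi / (s * τ)) ^ ((n : ℝ) / 2) * ∫ y, Real.exp (-s * ‖y‖ ^ 2) * f y := by
    rw [← integral_const_mul]
    congr 1
    ext y
    simp only [hslice, integral_mul_const, integral_const_mul, hshift]
    ring
  have e₂ : ∫ w : EuclideanSpace ℝ (Fin n), ∫ y : EuclideanSpace ℝ (Fin n),
      Real.exp (-(s * (‖y‖ ^ 2 + τ * ‖y - w‖ ^ 2))) * f w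
      = (Real.pi / (s * (1 + τ))) ^ ((n : ℝ) / 2) *
        ∫ w, Real.exp (-(τ / (1 + τ) * s) * ‖w‖ ^ 2) * f w := by
    rw [← integral_const_mul]
    congr 1
    ext w
    simp only [hslice', integral_mul_const]
    rw [integral_sub_right_eq_self (fun y : EuclideanSpace ℝ (Fin n) =>
      Real.exp (-(s * (1 + τ)) * ‖y‖ ^ 2)),
      GaussianFourier.integral_rexp_neg_mul_sq_norm hs1, finrank_euclideanSpace_fin]
    ring
  rw [e₁, e₂, gaussMean, gaussMean, mul_sub]
  have hsn : s ^ (-(n : ℝ)) = (s ^ ((n : ℝ) / 2))⁻¹ * (s ^ ((n : ℝ) / 2))⁻¹ := by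
    rw [← Real.rpow_neg hs.le, ← Real.rpow_add hs]
    ring_nf
  rw [hsn, Real.rpow_neg hτ.le, Real.div_rpow hpi.le hsτ.le, Real.div_rpow hpi.le hs1.le,
    Real.mul_rpow hs.le hτ.le, Real.mul_rpow hs.le (by positivity : 0 ≤ 1 + τ),
    Real.mul_rpow (by positivity : 0 ≤ τ / (1 + τ)) hs.le,
    Real.div_rpow hτ.le (by positivity : 0 ≤ 1 + τ)]
  have a₁ : 0 < s ^ ((n : ℝ) / 2) := by positivity
  have a₂ : 0 < τ ^ ((n : ℝ) / 2) := by positivity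
  have a₃ : 0 < (1 + τ) ^ ((n : ℝ) / 2) := by positivity
  congr 1 <;> field_simp

lemma integrableOn_rpow_mul_exp_neg_mul {a r : ℝ} (ha : 0 < a) (hr : 0 < r) :
    IntegrableOn (fun t : ℝ => t ^ (a - 1) * Real.exp (-(r * t))) (Set.Ioi 0) := by
  refine Integrable.of_integral_ne_zero ?_
  rw [Real.integral_rpow_mul_exp_neg_mul_Ioi ha hr]
  have := Real.Gamma_pos_of_pos ha
  positivity

/-- The product of powers `A ^ (-a) B ^ (-b)` as a superposition of exponentials. -/
lemma integrable_and_integral_rpow_mul_exp_pair {a b A B : ℝ} (ha : 0 < a) (hb : 0 < b)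
    (hA : 0 < A) (hB : 0 < B) :
    Integrable (fun σ : ℝ × ℝ => σ.1 ^ (a + b - 1) * σ.2 ^ (b - 1) *
      Real.exp (-(σ.1 * (A + σ.2 * B))))
      ((volume.restrict (Set.Ioi 0)).prod (volume.restrict (Set.Ioi 0))) ∧
    ∫ σ : ℝ × ℝ, σ.1 ^ (a + b - 1) * σ.2 ^ (b - 1) * Real.exp (-(σ.1 * (A + σ.2 * B)))
      ∂((volume.restrict (Set.Ioi 0)).prod (volume.restrict (Set.Ioi 0)))
      = Real.Gamma a * Real.Gamma b * (A ^ (-a) * B ^ (-b)) := by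
  have hsplit : ∀ s τ : ℝ, s ^ (a + b - 1) * τ ^ (b - 1) * Real.exp (-(s * (A + τ * B)))
      = s ^ (a + b - 1) * Real.exp (-(A * s)) * (τ ^ (b - 1) * Real.exp (-(s * B * τ))) := by
    intro s τ
    rw [show -(s * (A + τ * B)) = -(A * s) + -(s * B * τ) by ring, Real.exp_add]
    ring
  have hinner : ∀ s : ℝ, 0 < s → s ^ (a + b - 1) * Real.exp (-(A * s)) *
      ∫ τ in Set.Ioi 0, τ ^ (b - 1) * Real.exp (-(s * B * τ))
      = Real.Gamma b * B ^ (-b) * (s ^ (a - 1) * Real.exp (-(A * s))) := by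
    intro s hs
    rw [Real.integral_rpow_mul_exp_neg_mul_Ioi hb (by positivity), one_div,
      Real.inv_rpow (by positivity), ← Real.rpow_neg (by positivity), Real.mul_rpow hs.le hB.le,
      show a + b - 1 = (a - 1) + b by ring, Real.rpow_add hs, Real.rpow_neg hs.le]
    have : 0 < s ^ b := by positivity
    field_simp
  have hint : Integrable (fun σ : ℝ × ℝ => σ.1 ^ (a + b - 1) * σ.2 ^ (b - 1) *
      Real.exp (-(σ.1 * (A + σ.2 * B))))
      ((volume.restrict (Set.Ioi 0)).prod (volume.restrict (Set.Ioi 0))) := by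
    have hmeas : Measurable (fun σ : ℝ × ℝ => σ.1 ^ (a + b - 1) * σ.2 ^ (b - 1) *
      Real.exp (-(σ.1 * (A + σ.2 * B)))) := by fun_prop
    rw [integrable_prod_iff hmeas.aestronglyMeasurable]
    constructor
    · filter_upwards [ae_restrict_mem measurableSet_Ioi] with s hs
      simp only [hsplit]
      exact (integrableOn_rpow_mul_exp_neg_mul hb (mul_pos hs hB)).const_mul _
    · refine ((integrableOn_rpow_mul_exp_neg_mul ha hA).const_mul
        (Real.Gamma b * B ^ (-b))).congr ?_
      filter_upwards [ae_restrict_mem measurableSet_Ioi] with s hs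
      have hs : 0 < s := hs
      rw [← hinner s hs, ← integral_const_mul]
      refine setIntegral_congr_fun measurableSet_Ioi fun τ hτ => ?_
      have hτ : 0 < τ := hτ
      rw [← hsplit, Real.norm_of_nonneg (by positivity)]
  refine ⟨hint, ?_⟩
  rw [integral_prod _ hint]
  calc ∫ s in Set.Ioi 0, ∫ τ in Set.Ioi 0,
        s ^ (a + b - 1) * τ ^ (b - 1) * Real.exp (-(s * (A + τ * B)))
      = ∫ s in Set.Ioi 0, Real.Gamma b * B ^ (-b) * (s ^ (a - 1) * Real.exp (-(A * s))) := by
        refine setIntegral_congr_fun measurableSet_Ioi fun s hs => ?_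
        simp only [hsplit, integral_const_mul]
        exact hinner s hs
    _ = _ := by
        rw [integral_const_mul, Real.integral_rpow_mul_exp_neg_mul_Ioi ha hA, one_div,
          Real.inv_rpow hA.le, ← Real.rpow_neg hA.le]
        ring

/-- Inversion of the fractional Laplacian by the Riesz potential, at the origin. -/
lemma exists_apply_zero_eq_mul_integral_riesz {n : ℕ} (hn : 0 < n) {α : ℝ}
    (hα : α ∈ Set.Ioo (0 : ℝ) 1) :
    ∃ c : ℝ, ∀ f : EuclideanSpace ℝ (Fin n) → ℝ, ContDiff ℝ (⊤ : ℕ∞) f → HasCompactSupport f →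
      f 0 = c * ∫ p : EuclideanSpace ℝ (Fin n) × EuclideanSpace ℝ (Fin n),
        ‖p.1‖ ^ (-((n : ℝ) - α)) * ((f p.1 - f p.2) / ‖p.1 - p.2‖ ^ ((n : ℝ) + α)) := by
  have hn1 : (1 : ℝ) ≤ n := by exact_mod_cast hn
  have hα0 := hα.1
  have hα1 := hα.2
  have hpi := Real.pi_pos
  have : Nonempty (Fin n) := ⟨⟨0, hn⟩⟩
  set a : ℝ := ((n : ℝ) - α) / 2 with ha_def
  set b : ℝ := ((n : ℝ) + α) / 2 with hb_def
  have ha : 0 < a := by rw [ha_def]; linarith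
  have hb : 0 < b := by rw [hb_def]; linarith
  have hab : a + b = n := by rw [ha_def, hb_def]; ring
  have hΓ : 0 < Real.Gamma a * Real.Gamma b :=
    mul_pos (Real.Gamma_pos_of_pos ha) (Real.Gamma_pos_of_pos hb)
  set ν : Measure ℝ := volume.restrict (Set.Ioi 0) with hν
  set J : ℝ := ∫ τ, τ ^ (α / 2 - 1) * Real.log ((1 + τ) / τ) ∂ν with hJ
  refine ⟨Real.Gamma a * Real.Gamma b / (Real.pi ^ (n : ℝ) * J), fun f hf hfc => ?_⟩
  have hcont := hf.continuous
  have hfi : Integrable f := hcont.integrable_of_hasCompactSupport hfc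
  obtain ⟨B, hB⟩ := hfc.exists_bound_of_continuous hcont
  set F : EuclideanSpace ℝ (Fin n) × EuclideanSpace ℝ (Fin n) → ℝ := fun p =>
    ‖p.1‖ ^ (-((n : ℝ) - α)) * ((f p.1 - f p.2) / ‖p.1 - p.2‖ ^ ((n : ℝ) + α)) with hF
  have hFint : Integrable F := integrable_riesz_mul_fracLap_kernel hn hα hf hfc
  set G : EuclideanSpace ℝ (Fin n) × EuclideanSpace ℝ (Fin n) → ℝ × ℝ → ℝ := fun p σ =>
    σ.1 ^ (a + b - 1) * σ.2 ^ (b - 1) *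
      Real.exp (-(σ.1 * (‖p.1‖ ^ 2 + σ.2 * ‖p.1 - p.2‖ ^ 2))) * (f p.1 - f p.2) with hG
  have hpow : ∀ (r c : ℝ), 0 ≤ r → (r ^ 2) ^ (-(c / 2)) = (r ^ c)⁻¹ := by
    intro r c hr
    rw [← Real.rpow_natCast, ← Real.rpow_mul hr, ← Real.rpow_neg hr]
    congr 1
    push_cast
    ring
  have hslice : ∀ p : EuclideanSpace ℝ (Fin n) × EuclideanSpace ℝ (Fin n), p.1 ≠ 0 →
      Integrable (G p) (ν.prod ν) ∧ ∫ σ, G p σ ∂(ν.prod ν) = Real.Gamma a * Real.Gamma b * F p ∧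
      ∫ σ, ‖G p σ‖ ∂(ν.prod ν) = Real.Gamma a * Real.Gamma b * ‖F p‖ := by
    intro p hp
    rcases eq_or_ne p.1 p.2 with h | h
    · simp [hG, hF, h]
    have hA : 0 < ‖p.1‖ ^ 2 := by positivity
    have hsub : 0 < ‖p.1 - p.2‖ := norm_pos_iff.2 (sub_ne_zero.2 h)
    have hB' : 0 < ‖p.1 - p.2‖ ^ 2 := by positivity
    obtain ⟨h1, h2⟩ := integrable_and_integral_rpow_mul_exp_pair ha hb hA hB'
    rw [ha_def, hb_def, hpow _ _ (norm_nonneg _), hpow _ _ (norm_nonneg _), ← ha_def, ← hb_def,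
      ← Real.rpow_neg (norm_nonneg _)] at h2
    refine ⟨h1.mul_const _, ?_, ?_⟩
    · simp only [hG, integral_mul_const]
      rw [h2, hF]
      ring
    · have : ∫ σ, ‖G p σ‖ ∂(ν.prod ν) = ∫ σ : ℝ × ℝ, σ.1 ^ (a + b - 1) * σ.2 ^ (b - 1) *
          Real.exp (-(σ.1 * (‖p.1‖ ^ 2 + σ.2 * ‖p.1 - p.2‖ ^ 2))) * |f p.1 - f p.2|
          ∂(ν.prod ν) := by
        refine integral_congr_ae ?_
        rw [hν, Measure.prod_restrict]
        filter_upwards [ae_restrict_mem (measurableSet_Ioi.prod measurableSet_Ioi)] with σ hσ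
        have h1 : 0 < σ.1 := hσ.1
        have h2 : 0 < σ.2 := hσ.2
        rw [hG, norm_mul, Real.norm_of_nonneg (by positivity), Real.norm_eq_abs]
      rw [this, integral_mul_const, h2, hF, norm_mul, norm_div,
        Real.norm_of_nonneg (by positivity : 0 ≤ ‖p.1‖ ^ (-((n : ℝ) - α))),
        Real.norm_of_nonneg (by positivity : 0 ≤ ‖p.1 - p.2‖ ^ ((n : ℝ) + α)), Real.norm_eq_abs]
      ring
  have hae : ∀ᵐ p : EuclideanSpace ℝ (Fin n) × EuclideanSpace ℝ (Fin n), p.1 ≠ 0 := by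
    rw [Measure.volume_eq_prod]
    exact Measure.quasiMeasurePreserving_fst.ae (Measure.ae_ne volume 0)
  have hGint : Integrable (Function.uncurry G) (volume.prod (ν.prod ν)) := by
    have hfm := hcont.measurable
    have hmeas : Measurable (Function.uncurry G) := by
      simp only [hG, Function.uncurry_def]
      fun_prop
    rw [integrable_prod_iff hmeas.aestronglyMeasurable]
    constructor
    · filter_upwards [hae] with p hp
      exact (hslice p hp).1
    · refine (hFint.norm.const_mul (Real.Gamma a * Real.Gamma b)).congr ?_
      filter_upwards [hae] with p hp
      exact (hslice p hp).2.2.symm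
  have hinner : ∀ s τ : ℝ, 0 < s → 0 < τ → ∫ p, G p (s, τ) =
      Real.pi ^ ((n : ℝ) / 2) * τ ^ (α / 2 - 1) *
        (s⁻¹ * (gaussMean f (1 * s) - gaussMean f (τ / (1 + τ) * s))) := by
    intro s τ hs hτ
    simp only [hG, mul_assoc (_ * _) (Real.exp _) _, integral_const_mul]
    rw [integral_gaussian_pair_mul_sub hcont hfi hs hτ, hab, one_mul,
      show α / 2 - 1 = (b - 1) + -((n : ℝ) / 2) by rw [hb_def]; ring, Real.rpow_add hτ,
      show s⁻¹ = s ^ ((n : ℝ) - 1) * s ^ (-(n : ℝ)) by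
        rw [← Real.rpow_add hs, ← Real.rpow_neg_one]; ring_nf]
    ring
  have hloc : LocallyIntegrableOn (gaussMean f) (Set.Ioi 0) :=
    (continuousOn_gaussMean hcont hB).locallyIntegrableOn measurableSet_Ioi
  have hHint : Integrable (fun σ => ∫ p, G p σ) (ν.prod ν) := hGint.integral_prod_right
  have hfru : ∀ᵐ τ ∂ν, ∫ s, (∫ p, G p (s, τ)) ∂ν =
      Real.pi ^ (n : ℝ) * f 0 * (τ ^ (α / 2 - 1) * Real.log ((1 + τ) / τ)) := by
    filter_upwards [hHint.prod_left_ae, ae_restrict_mem measurableSet_Ioi] with τ hτint hτ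
    have hτ : 0 < τ := hτ
    have hq : 0 < Real.pi ^ ((n : ℝ) / 2) * τ ^ (α / 2 - 1) := by positivity
    have hκ : 0 < τ / (1 + τ) := by positivity
    have hcongr : (fun s => ∫ p, G p (s, τ)) =ᵐ[ν] fun s =>
        Real.pi ^ ((n : ℝ) / 2) * τ ^ (α / 2 - 1) *
          (s⁻¹ • (gaussMean f (1 * s) - gaussMean f (τ / (1 + τ) * s))) := by
      filter_upwards [ae_restrict_mem measurableSet_Ioi] with s hs
      exact hinner s τ hs hτ
    have hint : IntegrableOn (fun s : ℝ => s⁻¹ • (gaussMean f (1 * s) -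
        gaussMean f (τ / (1 + τ) * s))) (Set.Ioi 0) := by
      have := (hτint.congr hcongr).const_mul (Real.pi ^ ((n : ℝ) / 2) * τ ^ (α / 2 - 1))⁻¹
      simp only [inv_mul_cancel_left₀ hq.ne'] at this
      exact this
    rw [integral_congr_ae hcongr, integral_const_mul,
      Frullani.integral_Ioi_eq hloc one_pos hκ (tendsto_gaussMean_zero hn hfi)
        (tendsto_gaussMean_atTop hcont hB) hint, div_one, ← inv_div (1 + τ) τ, Real.log_inv,
      show (n : ℝ) = (n : ℝ) / 2 + (n : ℝ) / 2 by ring, Real.rpow_add hpi, smul_eq_mul]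
    ring_nf
  have hmain : Real.Gamma a * Real.Gamma b * ∫ p, F p = Real.pi ^ (n : ℝ) * f 0 * J := by
    calc Real.Gamma a * Real.Gamma b * ∫ p, F p = ∫ p, ∫ σ, G p σ ∂(ν.prod ν) := by
          rw [← integral_const_mul]
          refine integral_congr_ae ?_
          filter_upwards [hae] with p hp
          exact (hslice p hp).2.1.symm
      _ = ∫ σ, (∫ p, G p σ) ∂(ν.prod ν) := integral_integral_swap hGint
      _ = ∫ τ, ∫ s, (∫ p, G p (s, τ)) ∂ν ∂ν := integral_prod_symm _ hHint
      _ = _ := by rw [integral_congr_ae hfru, integral_const_mul]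
  rcases eq_or_ne (f 0) 0 with h0 | h0
  · rw [h0, mul_zero, zero_mul] at hmain
    rw [h0, (mul_eq_zero.1 hmain).resolve_left hΓ.ne', mul_zero]
  have hJint : Integrable (fun τ => τ ^ (α / 2 - 1) * Real.log ((1 + τ) / τ)) ν := by
    have h1 : Integrable (fun τ => ∫ s, (∫ p, G p (s, τ)) ∂ν) ν := hHint.integral_prod_right
    have h2 := (h1.congr hfru).const_mul (Real.pi ^ (n : ℝ) * f 0)⁻¹
    have hne : Real.pi ^ (n : ℝ) * f 0 ≠ 0 := mul_ne_zero (by positivity) h0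
    simpa only [inv_mul_cancel_left₀ hne] using h2
  have hpos : ∀ τ : ℝ, 0 < τ → 0 < τ ^ (α / 2 - 1) * Real.log ((1 + τ) / τ) := by
    intro τ hτ
    have : 0 < Real.log ((1 + τ) / τ) := Real.log_pos ((one_lt_div hτ).2 (by linarith))
    positivity
  have hJpos : 0 < J := by
    rw [hJ, hν, setIntegral_pos_iff_support_of_nonneg_ae
      ((ae_restrict_mem measurableSet_Ioi).mono fun τ hτ => (hpos τ hτ).le) hJint]
    have : Set.Ioi (0 : ℝ) ⊆ Function.support
        (fun τ : ℝ => τ ^ (α / 2 - 1) * Real.log ((1 + τ) / τ)) :=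
      fun τ hτ => (hpos τ hτ).ne'
    rw [Set.inter_eq_right.2 this, Real.volume_Ioi]
    exact ENNReal.zero_lt_top
  have : 0 < Real.pi ^ (n : ℝ) := by positivity
  rw [div_mul_eq_mul_div, hmain]
  field_simp

/-- Inversion of the fractional Laplacian by the Riesz potential. -/
lemma exists_eq_mul_integral_riesz_fracLap {n : ℕ} (hn : 0 < n) {α : ℝ}
    (hα : α ∈ Set.Ioo (0 : ℝ) 1) :
    ∃ c : ℝ, ∀ f : EuclideanSpace ℝ (Fin n) → ℝ, ContDiff ℝ (⊤ : ℕ∞) f → HasCompactSupport f →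
      ∀ z, Integrable (fun y => dist y z ^ (-((n : ℝ) - α)) * fracLap α f y) ∧
        f z = c * ∫ y, dist y z ^ (-((n : ℝ) - α)) * fracLap α f y := by
  obtain ⟨c, hc⟩ := exists_apply_zero_eq_mul_integral_riesz hn hα
  refine ⟨c, fun f hf hfc z => ?_⟩
  have hf' : ContDiff ℝ (⊤ : ℕ∞) fun y => f (y + z) := hf.comp (contDiff_id.add contDiff_const)
  have hfc' : HasCompactSupport fun y => f (y + z) := hfc.comp_homeomorph (Homeomorph.addRight z)
  have hint := integrable_riesz_mul_fracLap_kernel hn hα hf' hfc'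
  have hz := hc _ hf' hfc'
  rw [Measure.volume_eq_prod] at hint hz
  rw [integral_prod _ hint, zero_add] at hz
  have hint' := hint.integral_prod_left
  have htrans : ∀ y, ∫ w, ‖y‖ ^ (-((n : ℝ) - α)) *
      ((f (y + z) - f (w + z)) / ‖y - w‖ ^ ((n : ℝ) + α))
      = dist (y + z) z ^ (-((n : ℝ) - α)) * fracLap α f (y + z) := by
    intro y
    rw [integral_const_mul, dist_eq_norm, add_sub_cancel_right, fracLap,
      ← integral_add_right_eq_self (fun w => (f (y + z) - f w) / ‖y + z - w‖ ^ ((n : ℝ) + α)) z]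
    simp only [add_sub_add_right_eq_sub]
  simp only [htrans] at hint' hz
  refine ⟨?_, ?_⟩
  · have := hint'.comp_sub_right z
    simpa only [sub_add_cancel] using this
  · rw [hz, integral_add_right_eq_self
      (fun y => dist y z ^ (-((n : ℝ) - α)) * fracLap α f y) z]

lemma maxFn_nonneg {n : ℕ} (g : EuclideanSpace ℝ (Fin n) → ℝ) (x : EuclideanSpace ℝ (Fin n)) :
    0 ≤ maxFn g x :=
  Real.iSup_nonneg fun r => by
    rw [setAverage_eq, smul_eq_mul]
    exact mul_nonneg (inv_nonneg.2 measureReal_nonneg) (integral_nonneg fun z => abs_nonneg _)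

lemma setLIntegral_ball_le_maxFn_mul {n : ℕ} {g : EuclideanSpace ℝ (Fin n) → ℝ}
    (hg : Measurable g) {D : ℝ} (hD : ∀ y, |g y| ≤ D) (x : EuclideanSpace ℝ (Fin n)) {s : ℝ}
    (hs : 0 < s) :
    ∫⁻ y in Metric.ball x s, ENNReal.ofReal |g y|
      ≤ ENNReal.ofReal (maxFn g x) * volume (Metric.ball x s) := by
  have hint : ∀ s : ℝ, IntegrableOn (fun y => |g y|) (Metric.ball x s) := fun s =>
    Measure.integrableOn_of_bounded (M := D) measure_ball_lt_top.ne
      hg.abs.aestronglyMeasurable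
      (Filter.Eventually.of_forall fun y => by rw [Real.norm_eq_abs, abs_abs]; exact hD y)
  have hpos : ∀ {s : ℝ}, 0 < s → 0 < volume.real (Metric.ball x s) := fun hs =>
    ENNReal.toReal_pos (Metric.measure_ball_pos _ _ hs).ne' measure_ball_lt_top.ne
  have hbdd : BddAbove (Set.range fun r : {r : ℝ // 0 < r} => ⨍ z in Metric.ball x r.1, |g z|) := by
    refine ⟨D, ?_⟩
    rintro _ ⟨r, rfl⟩
    have hr := hpos r.2
    beta_reduce
    rw [setAverage_eq, smul_eq_mul, inv_mul_le_iff₀ hr]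
    calc ∫ z in Metric.ball x r.1, |g z| ≤ ∫ z in Metric.ball x r.1, D :=
          integral_mono (hint _) (integrableOn_const measure_ball_lt_top.ne) hD
      _ = _ := by rw [setIntegral_const, smul_eq_mul]
  have hle : ⨍ z in Metric.ball x s, |g z| ≤ maxFn g x := le_ciSup hbdd ⟨s, hs⟩
  rw [setAverage_eq, smul_eq_mul, inv_mul_le_iff₀ (hpos hs)] at hle
  rw [← ofReal_integral_eq_lintegral_ofReal (hint s)
    (Filter.Eventually.of_forall fun y => abs_nonneg _), ← ofReal_measureReal measure_ball_lt_top.ne,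
    ← ENNReal.ofReal_mul (maxFn_nonneg g x)]
  exact ENNReal.ofReal_le_ofReal (hle.trans (le_of_eq (mul_comm _ _)))

lemma measurable_fracLap {n : ℕ} (α : ℝ) {f : EuclideanSpace ℝ (Fin n) → ℝ} (hf : Continuous f) :
    Measurable (fracLap α f) := by
  have hfm := hf.measurable
  have : Measurable (Function.uncurry fun x y : EuclideanSpace ℝ (Fin n) =>
      (f x - f y) / ‖x - y‖ ^ ((n : ℝ) + α)) := by
    simp only [Function.uncurry_def]
    fun_prop
  exact this.stronglyMeasurable.integral_prod_right.measurable

lemma exists_abs_fracLap_le {n : ℕ} (hn : 0 < n) {α : ℝ} (hα : α ∈ Set.Ioo (0 : ℝ) 1)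
    {f : EuclideanSpace ℝ (Fin n) → ℝ} (hf : ContDiff ℝ (⊤ : ℕ∞) f) (hfc : HasCompactSupport f) :
    ∃ D : ℝ, ∀ y, |fracLap α f y| ≤ D := by
  obtain ⟨L, hL⟩ := ContDiff.lipschitzWith_of_hasCompactSupport hfc hf (by simp)
  obtain ⟨B, hB⟩ := hfc.exists_bound_of_continuous hf.continuous
  obtain ⟨D, hD, h⟩ := exists_lintegral_abs_sub_div_le hn hα hL hB
  refine ⟨D, fun y => ?_⟩
  rw [← Real.norm_eq_abs, ← ENNReal.ofReal_le_ofReal_iff hD, fracLap, ofReal_norm]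
  refine (enorm_integral_le_lintegral_enorm _).trans (le_trans (le_of_eq ?_) (h y))
  congr 1
  ext w
  rw [← ofReal_norm, norm_div, Real.norm_eq_abs,
    Real.norm_of_nonneg (by positivity : 0 ≤ ‖y - w‖ ^ ((n : ℝ) + α))]

lemma abs_rpow_neg_sub_rpow_neg_le {p r A B : ℝ} (hp : 0 < p) (hr : 0 < r) (hA : 2 * r ≤ A)
    (hAB : |A - B| ≤ r) :
    |A ^ (-p) - B ^ (-p)| ≤ p * 2 ^ (p + 1) * r * A ^ (-(p + 1)) := by
  have hA0 : 0 < A := by linarith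
  have hBA : A / 2 ≤ B := by linarith [(abs_le.1 hAB).2]
  have hderiv : ∀ t ∈ Set.Ici (A / 2), HasDerivWithinAt (fun t : ℝ => t ^ (-p))
      (-p * t ^ (-p - 1)) (Set.Ici (A / 2)) t := by
    intro t ht
    have ht0 : 0 < t := by linarith [Set.mem_Ici.1 ht]
    exact (Real.hasDerivAt_rpow_const (Or.inl ht0.ne')).hasDerivWithinAt
  have hbound : ∀ t ∈ Set.Ici (A / 2), ‖-p * t ^ (-p - 1)‖ ≤ p * (A / 2) ^ (-(p + 1)) := by
    intro t ht
    have ht0 : 0 < t := by linarith [Set.mem_Ici.1 ht]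
    rw [norm_mul, norm_neg, Real.norm_of_nonneg hp.le, Real.norm_of_nonneg (by positivity),
      show -p - 1 = -(p + 1) by ring]
    gcongr ?_ * ?_
    exact Real.rpow_le_rpow_of_nonpos (by positivity) ht (by linarith)
  have h := (convex_Ici (A / 2)).norm_image_sub_le_of_norm_hasDerivWithin_le hderiv hbound
    (Set.mem_Ici.2 hBA) (Set.mem_Ici.2 (by linarith : A / 2 ≤ A))
  rw [Real.norm_eq_abs, Real.norm_eq_abs] at h
  refine h.trans ?_
  rw [Real.div_rpow hA0.le (by norm_num), Real.rpow_neg (by norm_num : (0 : ℝ) ≤ 2), div_inv_eq_mul]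
  calc p * (A ^ (-(p + 1)) * 2 ^ (p + 1)) * |A - B|
      ≤ p * (A ^ (-(p + 1)) * 2 ^ (p + 1)) * r := by gcongr
    _ = _ := by ring

/-- The oscillation of the Riesz potential of `μ` over `ball x r`, in terms of the growth of `μ`
at `x`. -/
lemma exists_setLIntegral_lintegral_riesz_sub_le {n : ℕ} (hn : 0 < n) {α : ℝ}
    (hα : α ∈ Set.Ioo (0 : ℝ) 1) :
    ∃ C : ℝ, 0 < C ∧ ∀ (μ : Measure (EuclideanSpace ℝ (Fin n))) [SFinite μ]
      (x : EuclideanSpace ℝ (Fin n)) (K : ℝ), 0 ≤ K →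
      (∀ s : ℝ, 0 < s → μ (Metric.ball x s) ≤ ENNReal.ofReal K * ENNReal.ofReal (s ^ (n : ℝ))) →
      ∀ r : ℝ, 0 < r →
      ∫⁻ z in Metric.ball x r, ∫⁻ y, ENNReal.ofReal
          |dist y x ^ (-((n : ℝ) - α)) - dist y z ^ (-((n : ℝ) - α))| ∂μ
        ≤ ENNReal.ofReal (C * K * r ^ α * r ^ (n : ℝ)) := by
  have hn1 : (1 : ℝ) ≤ n := by exact_mod_cast hn
  have hα0 := hα.1
  have hα1 := hα.2
  set p : ℝ := (n : ℝ) - α with hp_def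
  have hp : 0 < p := by rw [hp_def]; linarith
  obtain ⟨C₁, hC₁, e₁⟩ := exists_setLIntegral_ball_dist_rpow_le (d := n) (p := p) hp
    (by rw [hp_def]; linarith)
  obtain ⟨C₂, hC₂, e₂⟩ := exists_setLIntegral_compl_ball_dist_rpow_le (d := n) (p := p + 1)
    (by linarith) (by rw [hp_def]; linarith)
  set V : ℝ := volume.real (Metric.ball (0 : EuclideanSpace ℝ (Fin n)) 1) with hV
  have hVpos : 0 < V :=
    ENNReal.toReal_pos (Metric.measure_ball_pos _ _ one_pos).ne' measure_ball_lt_top.ne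
  have hvol : ∀ (y : EuclideanSpace ℝ (Fin n)) (s : ℝ), 0 < s →
      volume (Metric.ball y s) = ENNReal.ofReal V * ENNReal.ofReal (s ^ (n : ℝ)) := by
    intro y s hs
    rw [volume_ball_eq_ofReal_rpow_mul y hs, hV, ofReal_measureReal measure_ball_lt_top.ne]
  refine ⟨C₁ * V * 2 ^ α + C₁ * V * 3 ^ α * 2 ^ (n : ℝ) +
    p * 2 ^ (p + 1) * C₂ * V * 2 ^ (α - 1), by positivity, fun μ _ x K hK hμ r hr => ?_⟩
  have hmd : Measurable fun q : EuclideanSpace ℝ (Fin n) × EuclideanSpace ℝ (Fin n) =>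
      ENNReal.ofReal (dist q.2 q.1 ^ (-p)) := by fun_prop
  have hball : MeasurableSet (Metric.ball x (2 * r)) := Metric.isOpen_ball.measurableSet
  have hnear₁ : ∫⁻ y in Metric.ball x (2 * r), ENNReal.ofReal (dist y x ^ (-p)) ∂μ
      ≤ ENNReal.ofReal (C₁ * K * (2 * r) ^ α) := by
    refine (e₁ μ x _ hμ (2 * r) (by positivity)).trans (le_of_eq ?_)
    rw [← ENNReal.ofReal_mul hC₁.le, ← ENNReal.ofReal_mul (by positivity), hp_def, sub_sub_cancel]
  have hnear₂ : ∫⁻ z in Metric.ball x r, ∫⁻ y in Metric.ball x (2 * r),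
      ENNReal.ofReal (dist y z ^ (-p)) ∂μ
      ≤ ENNReal.ofReal (C₁ * V * (3 * r) ^ α * (K * (2 * r) ^ (n : ℝ))) := by
    rw [lintegral_lintegral_swap hmd.aemeasurable]
    calc ∫⁻ y in Metric.ball x (2 * r), (∫⁻ z in Metric.ball x r,
          ENNReal.ofReal (dist y z ^ (-p))) ∂μ
        ≤ ∫⁻ y in Metric.ball x (2 * r), ENNReal.ofReal (C₁ * V * (3 * r) ^ α) ∂μ := by
          refine setLIntegral_mono' hball fun y hy => ?_
          have hsub : Metric.ball x r ⊆ Metric.ball y (3 * r) := by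
            refine Metric.ball_subset_ball' ?_
            rw [dist_comm]
            linarith [Metric.mem_ball.1 hy]
          refine (lintegral_mono_set hsub).trans ?_
          simp only [dist_comm y]
          refine (e₁ volume y _ (fun s hs => (hvol y s hs).le) (3 * r) (by positivity)).trans
            (le_of_eq ?_)
          rw [← ENNReal.ofReal_mul hC₁.le, ← ENNReal.ofReal_mul (by positivity), hp_def,
            sub_sub_cancel]
      _ = ENNReal.ofReal (C₁ * V * (3 * r) ^ α) * μ (Metric.ball x (2 * r)) := by
          rw [setLIntegral_const]
      _ ≤ ENNReal.ofReal (C₁ * V * (3 * r) ^ α) *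
            (ENNReal.ofReal K * ENNReal.ofReal ((2 * r) ^ (n : ℝ))) := by
          gcongr
          exact hμ _ (by positivity)
      _ = _ := by
          rw [← ENNReal.ofReal_mul hK, ← ENNReal.ofReal_mul (by positivity)]
  have hfar : ∀ z ∈ Metric.ball x r, ∫⁻ y in (Metric.ball x (2 * r))ᶜ,
      ENNReal.ofReal |dist y x ^ (-p) - dist y z ^ (-p)| ∂μ
      ≤ ENNReal.ofReal (p * 2 ^ (p + 1) * r * (C₂ * K * (2 * r) ^ (α - 1))) := by
    intro z hz
    calc ∫⁻ y in (Metric.ball x (2 * r))ᶜ, ENNReal.ofReal |dist y x ^ (-p) - dist y z ^ (-p)| ∂μ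
        ≤ ∫⁻ y in (Metric.ball x (2 * r))ᶜ, ENNReal.ofReal (p * 2 ^ (p + 1) * r) *
            ENNReal.ofReal (dist y x ^ (-(p + 1))) ∂μ := by
          refine setLIntegral_mono' hball.compl fun y hy => ?_
          rw [Set.mem_compl_iff, Metric.mem_ball, not_lt] at hy
          rw [← ENNReal.ofReal_mul (by positivity)]
          refine ENNReal.ofReal_le_ofReal (abs_rpow_neg_sub_rpow_neg_le hp hr hy ?_)
          rw [dist_comm y x, dist_comm y z]
          exact (abs_dist_sub_le x z y).trans (by rw [dist_comm]; exact (Metric.mem_ball.1 hz).le)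
      _ ≤ _ := by
          rw [lintegral_const_mul' _ _ ENNReal.ofReal_ne_top,
            ENNReal.ofReal_mul (p := p * 2 ^ (p + 1) * r) (by positivity)]
          refine mul_le_mul' le_rfl ?_
          refine (e₂ μ x _ hμ (2 * r) (by positivity)).trans (le_of_eq ?_)
          rw [← ENNReal.ofReal_mul hC₂.le, ← ENNReal.ofReal_mul (by positivity), hp_def]
          ring_nf
  have hpoint : ∀ z ∈ Metric.ball x r,
      ∫⁻ y, ENNReal.ofReal |dist y x ^ (-p) - dist y z ^ (-p)| ∂μ
      ≤ ENNReal.ofReal (C₁ * K * (2 * r) ^ α) +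
          ENNReal.ofReal (p * 2 ^ (p + 1) * r * (C₂ * K * (2 * r) ^ (α - 1))) +
        ∫⁻ y in Metric.ball x (2 * r), ENNReal.ofReal (dist y z ^ (-p)) ∂μ := by
    intro z hz
    rw [← lintegral_add_compl _ hball, add_right_comm]
    refine add_le_add ?_ (hfar z hz)
    calc ∫⁻ y in Metric.ball x (2 * r), ENNReal.ofReal |dist y x ^ (-p) - dist y z ^ (-p)| ∂μ
        ≤ ∫⁻ y in Metric.ball x (2 * r), (ENNReal.ofReal (dist y x ^ (-p)) +
            ENNReal.ofReal (dist y z ^ (-p))) ∂μ := by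
          refine lintegral_mono fun y => ?_
          rw [← ENNReal.ofReal_add (by positivity) (by positivity)]
          refine ENNReal.ofReal_le_ofReal ((abs_sub _ _).trans (le_of_eq ?_))
          rw [abs_of_nonneg (by positivity), abs_of_nonneg (by positivity)]
      _ ≤ _ := by
          rw [lintegral_add_left (by fun_prop)]
          exact add_le_add hnear₁ le_rfl
  refine (setLIntegral_mono' Metric.isOpen_ball.measurableSet hpoint).trans ?_
  rw [lintegral_add_left measurable_const, setLIntegral_const, hvol x r hr,
    ← ENNReal.ofReal_add (by positivity) (by positivity), ← ENNReal.ofReal_mul hVpos.le,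
    ← ENNReal.ofReal_mul (by positivity)]
  refine (add_le_add_right hnear₂ _).trans ?_
  rw [← ENNReal.ofReal_add (by positivity) (by positivity)]
  apply ENNReal.ofReal_le_ofReal
  have hrα : r * r ^ (α - 1) = r ^ α := by
    rw [← Real.rpow_one_add' hr.le (by linarith)]
    ring_nf
  rw [Real.mul_rpow (by norm_num) hr.le, Real.mul_rpow (by norm_num) hr.le,
    Real.mul_rpow (by norm_num) hr.le, Real.mul_rpow (by norm_num) hr.le, ← hrα]
  apply le_of_eq
  ring

/-- For `α ∈ (0,1)` and `f` smooth with compact support: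
`|f(x) − (f)_{B(x,r)}| ≲ r^α · M((−Δ)^{α/2} f)(x)`, with constant depending only on `n, α`. -/
theorem fracLap_ball_average_bound (n : ℕ) (α : ℝ) (hα : α ∈ Set.Ioo (0:ℝ) 1) :
    ∃ C : ℝ, 0 < C ∧
      ∀ f : EuclideanSpace ℝ (Fin n) → ℝ, ContDiff ℝ (⊤ : ℕ∞) f → HasCompactSupport f →
        ∀ x : EuclideanSpace ℝ (Fin n), ∀ r : ℝ, 0 < r →
          |f x - ⨍ z in Metric.ball x r, f z| ≤ C * r ^ α * maxFn (fracLap α f) x := by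
  rcases Nat.eq_zero_or_pos n with rfl | hn
  · refine ⟨1, one_pos, fun f _ _ x r hr => ?_⟩
    have hconst : f = fun _ => f x := funext fun y => by rw [Subsingleton.elim y x]
    have havg : ⨍ z in Metric.ball x r, f z = f x := by
      rw [hconst]
      exact setAverage_const (Metric.measure_ball_pos _ _ hr).ne' measure_ball_lt_top.ne _
    rw [havg, sub_self, abs_zero]
    exact mul_nonneg (by positivity) (maxFn_nonneg _ _)
  obtain ⟨c, hc⟩ := exists_eq_mul_integral_riesz_fracLap hn hα
  obtain ⟨C, hC, hosc⟩ := exists_setLIntegral_lintegral_riesz_sub_le hn hα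
  set V : ℝ := volume.real (Metric.ball (0 : EuclideanSpace ℝ (Fin n)) 1) with hV
  have hVpos : 0 < V :=
    ENNReal.toReal_pos (Metric.measure_ball_pos _ _ one_pos).ne' measure_ball_lt_top.ne
  refine ⟨(|c| + 1) * C, by positivity, fun f hf hfc x r hr => ?_⟩
  set g := fracLap α f with hg
  have hgm : Measurable g := measurable_fracLap α hf.continuous
  obtain ⟨D, hD⟩ := exists_abs_fracLap_le hn hα hf hfc
  have hM : 0 ≤ maxFn g x := maxFn_nonneg g x
  set μ : Measure (EuclideanSpace ℝ (Fin n)) :=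
    volume.withDensity fun y => ENNReal.ofReal |g y| with hμ_def
  have hgm' : Measurable fun y => ENNReal.ofReal |g y| := by fun_prop
  have hvol : ∀ s : ℝ, 0 < s →
      volume (Metric.ball x s) = ENNReal.ofReal V * ENNReal.ofReal (s ^ (n : ℝ)) := by
    intro s hs
    rw [volume_ball_eq_ofReal_rpow_mul x hs, hV, ofReal_measureReal measure_ball_lt_top.ne]
  have hμ : ∀ s : ℝ, 0 < s → μ (Metric.ball x s) ≤
      ENNReal.ofReal (maxFn g x * V) * ENNReal.ofReal (s ^ (n : ℝ)) := by
    intro s hs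
    rw [hμ_def, withDensity_apply _ Metric.isOpen_ball.measurableSet, ENNReal.ofReal_mul hM,
      mul_assoc, ← hvol s hs]
    exact setLIntegral_ball_le_maxFn_mul hgm hD x hs
  have hosc' := hosc μ x (maxFn g x * V) (by positivity) hμ r hr
  have hpoint : ∀ z, ENNReal.ofReal |f x - f z| ≤ ENNReal.ofReal |c| *
      ∫⁻ y, ENNReal.ofReal |dist y x ^ (-((n : ℝ) - α)) - dist y z ^ (-((n : ℝ) - α))| ∂μ := by
    intro z
    obtain ⟨hix, hx⟩ := hc f hf hfc x
    obtain ⟨hiz, hz⟩ := hc f hf hfc z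
    rw [hx, hz, ← mul_sub, ← integral_sub hix hiz, abs_mul, ENNReal.ofReal_mul (abs_nonneg _),
      hμ_def, lintegral_withDensity_eq_lintegral_mul _ hgm' (by fun_prop)]
    gcongr
    rw [← Real.norm_eq_abs, ofReal_norm]
    refine (enorm_integral_le_lintegral_enorm _).trans (le_of_eq ?_)
    congr 1
    ext y
    rw [Pi.mul_apply, ← sub_mul, ← ofReal_norm, norm_mul, ENNReal.ofReal_mul (norm_nonneg _),
      Real.norm_eq_abs, Real.norm_eq_abs, mul_comm]
  have hcont : Continuous f := hf.continuous
  have hballfin : IsFiniteMeasure (volume.restrict (Metric.ball x r)) := by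
    rw [isFiniteMeasure_restrict]
    exact measure_ball_lt_top.ne
  have hfint : IntegrableOn f (Metric.ball x r) :=
    (hcont.integrable_of_hasCompactSupport hfc).integrableOn
  have hdiff : IntegrableOn (fun z => f x - f z) (Metric.ball x r) :=
    (integrable_const (f x)).sub hfint
  have hlint : ∫ z in Metric.ball x r, |f x - f z|
      ≤ |c| * (C * (maxFn g x * V) * r ^ α * r ^ (n : ℝ)) := by
    rw [← ENNReal.ofReal_le_ofReal_iff (by positivity),
      ofReal_integral_eq_lintegral_ofReal hdiff.abs
        (Filter.Eventually.of_forall fun y => abs_nonneg _), ENNReal.ofReal_mul (abs_nonneg _)]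
    refine (lintegral_mono hpoint).trans ?_
    rw [lintegral_const_mul' _ _ ENNReal.ofReal_ne_top]
    gcongr
  have hvolr : volume.real (Metric.ball x r) = V * r ^ (n : ℝ) := by
    rw [measureReal_def, hvol r hr, ← ENNReal.ofReal_mul hVpos.le,
      ENNReal.toReal_ofReal (by positivity)]
  have hpos : 0 < V * r ^ (n : ℝ) := by positivity
  have havg : f x - ⨍ z in Metric.ball x r, f z
      = (V * r ^ (n : ℝ))⁻¹ * ∫ z in Metric.ball x r, (f x - f z) := by
    rw [setAverage_eq, hvolr, smul_eq_mul, integral_sub (integrable_const _) hfint,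
      setIntegral_const, hvolr, smul_eq_mul]
    field_simp
  rw [havg, abs_mul, abs_of_pos (inv_pos.2 hpos), inv_mul_le_iff₀ hpos]
  calc |∫ z in Metric.ball x r, (f x - f z)| ≤ ∫ z in Metric.ball x r, |f x - f z| :=
        abs_integral_le_integral_abs
    _ ≤ |c| * (C * (maxFn g x * V) * r ^ α * r ^ (n : ℝ)) := hlint
    _ ≤ (|c| + 1) * (C * (maxFn g x * V) * r ^ α * r ^ (n : ℝ)) := by
        gcongr
        linarith
    _ = _ := by ring
end

section
/- With the notation of the half-plane Hodge decomposition F = ∇φ + H: for every k ≥ 0 and every x ∈ ℝ²₊ with dist(x, supp F) > Λ > 0 one has |∇^k φ(x)| ≲ Λ^{−k−1} ‖F‖_{L¹(ℝ²₊)} and |∇^k H(x)| ≲ Λ^{−k−2} ‖F‖_{L¹(ℝ²₊)}. -/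
open MeasureTheory

/-- The open upper half-plane `ℝ²₊`. -/
def upperHalf : Set (ℝ × ℝ) := {z | 0 < z.2}

section HalfPlaneHodge

open scoped ContDiff Convolution

lemma locallyIntegrable_complex_inv : LocallyIntegrable (fun w : ℂ => w⁻¹) := by
  refine locallyIntegrable_of_norm_le_rpow (C := 1) (α := 1) (by simp) (by simp) ?_ ?_
  · filter_upwards with x
    simp [Real.rpow_neg_one]
  · exact measurable_inv.aestronglyMeasurable

/-- The Cauchy transform of a function on the complex plane. -/
noncomputable def cauchyTransform (g : ℂ → ℂ) (z : ℂ) : ℂ := ∫ w, w⁻¹ * g (z - w)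

lemma cauchyTransform_eq (g : ℂ → ℂ) (z : ℂ) :
    cauchyTransform g z = ∫ y, (z - y)⁻¹ * g y := by
  rw [cauchyTransform, ← integral_sub_left_eq_self _ volume z]
  simp

lemma integral_inv_mul_dbar {G : ℂ → ℂ} (hG : ContDiff ℝ 1 G) (hc : HasCompactSupport G) :
    ∫ w, w⁻¹ * (fderiv ℝ G w 1 + Complex.I * fderiv ℝ G w Complex.I) =
      -(2 * Real.pi) * G 0 := by
  have hd : Continuous (fderiv ℝ G) := hG.continuous_fderiv one_ne_zero
  have hdc : HasCompactSupport (fderiv ℝ G) := hc.fderiv ℝ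
  let u : ℝ × ℝ → ℂ := fun p => fderiv ℝ G (p.1 * Complex.exp (p.2 * Complex.I)) (Complex.exp (p.2 * Complex.I))
  let v : ℝ × ℝ → ℂ := fun p => fderiv ℝ G (p.1 * Complex.exp (p.2 * Complex.I)) (Complex.I * Complex.exp (p.2 * Complex.I))
  have hu : Continuous u := by fun_prop
  have hv : Continuous v := by fun_prop
  obtain ⟨R, hR⟩ : ∃ R : ℝ, ∀ w : ℂ, R < ‖w‖ → fderiv ℝ G w = 0 := by
    obtain ⟨R, hR⟩ := hdc.isBounded.exists_norm_le
    exact ⟨R, fun w hw => by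
      by_contra h
      exact absurd (hR w (subset_tsupport _ h)) (not_le.2 hw)⟩
  have key : ∀ f : ℝ × ℝ → ℂ, Continuous f → (∀ p : ℝ × ℝ, R < p.1 → f p = 0) →
      IntegrableOn f (Set.Ioi 0 ×ˢ Set.Ioo (-Real.pi) Real.pi) := by
    intro f hf h0
    have h1 : IntegrableOn f (Set.Icc 0 R ×ˢ Set.Icc (-Real.pi) Real.pi) :=
      hf.continuousOn.integrableOn_compact (isCompact_Icc.prod isCompact_Icc)
    refine h1.of_forall_sdiff_eq_zero (measurableSet_Ioi.prod measurableSet_Ioo) ?_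
    rintro ⟨r, θ⟩ ⟨⟨h1, h2⟩, h3⟩
    apply h0
    by_contra h
    exact h3 ⟨⟨le_of_lt h1, not_lt.1 h⟩, ⟨h2.1.le, h2.2.le⟩⟩
  have hzero : ∀ p : ℝ × ℝ, R < p.1 → fderiv ℝ G (p.1 * Complex.exp (p.2 * Complex.I)) = 0 := by
    intro p hp
    apply hR
    rw [norm_mul, Complex.norm_exp_ofReal_mul_I, Complex.norm_real, mul_one]
    exact hp.trans_le (le_abs_self _)
  have hui := key u hu (fun p hp => by simp [u, hzero p hp])
  have hvi := key v hv (fun p hp => by simp [v, hzero p hp])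
  have huI : ∫ p in Set.Ioi (0:ℝ) ×ˢ Set.Ioo (-Real.pi) Real.pi, u p = -(2 * Real.pi) * G 0 := by
    rw [Measure.volume_eq_prod, ← setIntegral_prod_swap, setIntegral_prod]
    · have : ∀ θ : ℝ, ∫ r in Set.Ioi (0:ℝ), u (r, θ) = - G 0 := by
        intro θ
        have hder : ∀ r : ℝ, HasDerivAt (fun r : ℝ => G (r * Complex.exp (θ * Complex.I))) (u (r, θ)) r := by
          intro r
          have h1 : HasDerivAt (fun r : ℝ => (r : ℂ) * Complex.exp (θ * Complex.I))
              (1 * Complex.exp (θ * Complex.I)) r := (Complex.ofRealCLM.hasDerivAt).mul_const _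
          rw [one_mul] at h1
          exact ((hG.differentiable one_ne_zero _).hasFDerivAt).comp_hasDerivAt r h1
        have hinteg : IntegrableOn (fun r => u (r, θ)) (Set.Ioi 0) := by
          have h1 : IntegrableOn (fun r => u (r, θ)) (Set.Icc 0 R) :=
            (hu.comp (by fun_prop : Continuous fun r : ℝ => (r, θ))).continuousOn.integrableOn_compact isCompact_Icc
          refine h1.of_forall_sdiff_eq_zero measurableSet_Ioi ?_
          rintro r ⟨h1, h3⟩
          have : R < r := by
            by_contra h
            exact h3 ⟨le_of_lt h1, not_lt.1 h⟩
          simp [u, hzero (r, θ) this]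
        have hlim : Filter.Tendsto (fun r : ℝ => G (r * Complex.exp (θ * Complex.I))) Filter.atTop (nhds 0) := by
          obtain ⟨R', hR'⟩ := hc.isBounded.exists_norm_le
          apply tendsto_const_nhds.congr'
          filter_upwards [Filter.eventually_gt_atTop R', Filter.eventually_gt_atTop 0] with r hr hr0
          by_contra h
          have := hR' _ (subset_tsupport _ (Ne.symm h))
          rw [norm_mul, Complex.norm_exp_ofReal_mul_I, Complex.norm_real, mul_one, Real.norm_of_nonneg hr0.le] at this
          linarith
        have := integral_Ioi_of_hasDerivAt_of_tendsto (hder 0).continuousAt.continuousWithinAt (fun r _ => hder r) hinteg hlim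
        simpa using this
      simp only [Prod.swap, this]
      simp [Real.pi_pos.le, two_mul]
      ring
    · exact hui.swap
  have hvI : ∫ p in Set.Ioi (0:ℝ) ×ˢ Set.Ioo (-Real.pi) Real.pi, v p = 0 := by
    rw [Measure.volume_eq_prod, setIntegral_prod _ hvi]
    refine setIntegral_eq_zero_of_forall_eq_zero fun r hr => ?_
    have hr' : (r : ℂ) ≠ 0 := by exact_mod_cast (ne_of_gt hr)
    have hder : ∀ θ : ℝ, HasDerivAt (fun θ : ℝ => (r : ℂ)⁻¹ * G (r * Complex.exp (θ * Complex.I))) (v (r, θ)) θ := by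
      intro θ
      have h1 : HasDerivAt (fun θ : ℝ => (r : ℂ) * Complex.exp (θ * Complex.I))
          (r * (Complex.exp (θ * Complex.I) * (1 * Complex.I))) θ :=
        (((Complex.ofRealCLM.hasDerivAt (x := θ)).mul_const Complex.I).cexp).const_mul _
      have h2 := (((hG.differentiable one_ne_zero _).hasFDerivAt).comp_hasDerivAt θ h1).const_mul (r : ℂ)⁻¹
      refine h2.congr_deriv ?_
      have : (r : ℂ) * (Complex.exp (θ * Complex.I) * (1 * Complex.I)) = r • (Complex.I * Complex.exp (θ * Complex.I)) := by
        rw [Complex.real_smul]; ring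
      rw [this, map_smul, Complex.real_smul, ← mul_assoc, inv_mul_cancel₀ hr', one_mul]
    rw [← integral_Ioc_eq_integral_Ioo, ← intervalIntegral.integral_of_le (by linarith [Real.pi_pos]),
      intervalIntegral.integral_eq_sub_of_hasDerivAt (fun θ _ => hder θ)
      ((hv.comp (by fun_prop : Continuous fun θ : ℝ => (r, θ))).intervalIntegrable _ _)]
    simp [Complex.exp_neg]
  rw [← Complex.integral_comp_polarCoord_symm, polarCoord_target]
  rw [setIntegral_congr_fun (g := fun p => u p + Complex.I * v p) (measurableSet_Ioi.prod measurableSet_Ioo)]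
  · rw [integral_add hui (hvi.const_mul _), integral_const_mul, huI, hvI]
    simp
  · rintro ⟨r, θ⟩ ⟨hr, -⟩
    have hr' : (r : ℂ) ≠ 0 := by exact_mod_cast (ne_of_gt hr)
    have hp : Complex.polarCoord.symm (r, θ) = r * Complex.exp (θ * Complex.I) := by
      rw [Complex.polarCoord_symm_apply, Complex.exp_mul_I]; simp
    have he : Complex.exp (θ * Complex.I) = Real.cos θ • (1 : ℂ) + Real.sin θ • Complex.I := by
      rw [Complex.exp_mul_I]; simp
    have hI : Complex.I * Complex.exp (θ * Complex.I) = (-Real.sin θ) • (1 : ℂ) + Real.cos θ • Complex.I := by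
      rw [Complex.exp_mul_I]; simp
      linear_combination (Complex.sin θ) * Complex.I_sq
    simp only [u, v, hp]
    generalize fderiv ℝ G (r * Complex.exp (θ * Complex.I)) = L
    rw [hI, show L (Complex.exp (θ * Complex.I)) = _ from congrArg L he]
    simp only [map_add, map_smul]
    simp only [Complex.real_smul, mul_inv, ← Complex.exp_neg]
    have : Complex.exp (-(θ * Complex.I)) = Complex.cos θ - Complex.sin θ * Complex.I := by
      rw [← neg_mul, Complex.exp_mul_I]; simp; ring
    rw [this]
    push_cast
    field_simp
    linear_combination (-Complex.sin θ * L Complex.I) * Complex.I_sq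

lemma cauchyTransform_eq_convolution (g : ℂ → ℂ) :
    cauchyTransform g = (fun w : ℂ => w⁻¹) ⋆[ContinuousLinearMap.mul ℝ ℂ] g := rfl

lemma contDiff_cauchyTransform {g : ℂ → ℂ} (hg : ContDiff ℝ ∞ g) (hc : HasCompactSupport g) :
    ContDiff ℝ ∞ (cauchyTransform g) := by
  rw [cauchyTransform_eq_convolution]
  exact hc.contDiff_convolution_right _ locallyIntegrable_complex_inv hg

lemma dbar_cauchyTransform {g : ℂ → ℂ} (hg : ContDiff ℝ ∞ g) (hc : HasCompactSupport g) (z : ℂ) :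
    fderiv ℝ (cauchyTransform g) z 1 + Complex.I * fderiv ℝ (cauchyTransform g) z Complex.I =
      2 * Real.pi * g z := by
  have hg1 : ContDiff ℝ 1 g := hg.of_le (by exact_mod_cast le_top)
  have h := hc.hasFDerivAt_convolution_right (ContinuousLinearMap.mul ℝ ℂ) locallyIntegrable_complex_inv hg1 z
  rw [cauchyTransform_eq_convolution, h.fderiv]
  have hex : ConvolutionExistsAt (fun w : ℂ => w⁻¹) (fderiv ℝ g) z ((ContinuousLinearMap.mul ℝ ℂ).precompR ℂ) :=
    (hc.fderiv ℝ).convolutionExists_right _ locallyIntegrable_complex_inv (hg1.continuous_fderiv one_ne_zero) z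
  have hap : ∀ v : ℂ, Integrable (fun w : ℂ => w⁻¹ * fderiv ℝ g (z - w) v) ∧ ((fun w : ℂ => w⁻¹) ⋆[(ContinuousLinearMap.mul ℝ ℂ).precompR ℂ] fderiv ℝ g) z v =
      ∫ w : ℂ, w⁻¹ * fderiv ℝ g (z - w) v := by
    intro v
    refine ⟨((ContinuousLinearMap.apply ℝ ℂ v).integrable_comp hex), ?_⟩
    rw [convolution, ContinuousLinearMap.integral_apply hex]
    rfl
  rw [(hap 1).2, (hap _).2, ← integral_const_mul, ← integral_add (hap 1).1 ((hap _).1.const_mul _)]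
  have hG : ContDiff ℝ 1 (fun w => g (z - w)) := by fun_prop
  have hGc : HasCompactSupport (fun w => g (z - w)) := hc.comp_homeomorph (Homeomorph.subLeft z)
  have hGd : ∀ w, fderiv ℝ (fun w => g (z - w)) w = - fderiv ℝ g (z - w) := by
    intro w
    have h1 : HasFDerivAt (fun w : ℂ => z - w) (-ContinuousLinearMap.id ℝ ℂ) w :=
      (hasFDerivAt_id w).const_sub z
    have h2 := ((hg1.differentiable one_ne_zero (z - w)).hasFDerivAt.comp w h1).fderiv
    exact h2.trans (by ext; simp)
  have := integral_inv_mul_dbar hG hGc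
  simp only [hGd, sub_zero, neg_mul] at this
  rw [eq_comm, ← neg_inj, ← this, ← integral_neg]
  congr 1; ext w
  simp; ring

/-- A measurable, bounded function vanishing outside some ball. -/
structure BddCompact (g : ℂ → ℂ) : Prop where
  measurable : Measurable g
  bdd : ∃ M, ∀ y, ‖g y‖ ≤ M
  supp : ∃ R, ∀ y, R < ‖y‖ → g y = 0

namespace BddCompact

variable {g : ℂ → ℂ}

lemma of_continuous (hg : Continuous g) (hc : HasCompactSupport g) : BddCompact g where
  measurable := hg.measurable
  bdd := hg.bounded_above_of_compact_support hc
  supp := by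
    obtain ⟨R, hR⟩ := hc.isBounded.exists_norm_le
    exact ⟨R, fun w hw => by
      by_contra h
      exact absurd (hR w (subset_tsupport _ h)) (not_le.2 hw)⟩

lemma indicator (hg : BddCompact g) {s : Set ℂ} (hs : MeasurableSet s) :
    BddCompact (s.indicator g) where
  measurable := hg.measurable.indicator hs
  bdd := hg.bdd.imp fun _ h y => (norm_indicator_le_norm_self g y).trans (h y)
  supp := hg.supp.imp fun _ h y hy => by simp [Set.indicator, h y hy]

lemma conj_reflect (hg : BddCompact g) :
    BddCompact (fun y => starRingEnd ℂ (g (starRingEnd ℂ y))) where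
  measurable := (Complex.continuous_conj.measurable.comp
    (hg.measurable.comp Complex.continuous_conj.measurable))
  bdd := hg.bdd.imp fun _ h y => by simpa using h _
  supp := hg.supp.imp fun _ h y hy => by rw [h _ (by simpa using hy), map_zero]

lemma integrable (hg : BddCompact g) : Integrable g := by
  obtain ⟨M, hM⟩ := hg.bdd
  obtain ⟨R, hR⟩ := hg.supp
  refine (integrableOn_iff_integrable_of_support_subset (s := Metric.closedBall 0 R) ?_).1 ?_
  · intro y hy
    by_contra h
    exact hy (hR y (by simpa using h))
  · exact Measure.integrableOn_of_bounded (M := M) measure_closedBall_lt_top.ne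
      hg.measurable.aestronglyMeasurable (ae_of_all _ hM)

/-- A majorant for the Cauchy kernel integrand, uniform for `z` in a ball. -/
lemma exists_bound (hg : BddCompact g) (r : ℝ) :
    ∃ b : ℂ → ℝ, Integrable b ∧ ∀ z : ℂ, ‖z‖ ≤ r → ∀ w, ‖w⁻¹ * g (z - w)‖ ≤ b w := by
  obtain ⟨M, hM⟩ := hg.bdd
  obtain ⟨R, hR⟩ := hg.supp
  refine ⟨(Metric.closedBall 0 (R + r)).indicator (fun w => ‖w⁻¹‖ * M), ?_, ?_⟩
  · rw [integrable_indicator_iff Metric.isClosed_closedBall.measurableSet]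
    exact ((locallyIntegrable_complex_inv.integrableOn_isCompact
      (isCompact_closedBall _ _)).norm).mul_const M
  · intro z hz w
    by_cases hw : w ∈ Metric.closedBall (0 : ℂ) (R + r)
    · rw [Set.indicator_of_mem hw, norm_mul]
      exact mul_le_mul_of_nonneg_left (hM _) (norm_nonneg _)
    · rw [Set.indicator_of_notMem hw, hR, mul_zero, norm_zero]
      rw [mem_closedBall_zero_iff, not_le] at hw
      have := norm_sub_norm_le w z
      rw [norm_sub_rev] at this
      linarith

lemma integrable_kernel (hg : BddCompact g) (z : ℂ) :
    Integrable (fun w => w⁻¹ * g (z - w)) := by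
  obtain ⟨b, hb, hle⟩ := hg.exists_bound ‖z‖
  exact hb.mono' (measurable_inv.mul
    (hg.measurable.comp (measurable_const.sub measurable_id))).aestronglyMeasurable
    (ae_of_all _ (hle z le_rfl))

lemma cauchyTransform_sub {f : ℂ → ℂ} (hg : BddCompact g) (hf : BddCompact f) (z : ℂ) :
    cauchyTransform (fun y => g y - f y) z = cauchyTransform g z - cauchyTransform f z := by
  simp only [cauchyTransform, mul_sub]
  exact integral_sub (hg.integrable_kernel z) (hf.integrable_kernel z)

lemma continuous_cauchyTransform (hg : BddCompact g) (hcont : ∀ᵐ y, ContinuousAt g y) :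
    Continuous (cauchyTransform g) := by
  rw [continuous_iff_continuousAt]
  intro z
  obtain ⟨b, hb, hle⟩ := hg.exists_bound (‖z‖ + 1)
  refine continuousAt_of_dominated (bound := b) ?_ ?_ hb ?_
  · exact Filter.Eventually.of_forall fun z => (hg.integrable_kernel z).aestronglyMeasurable
  · filter_upwards [Metric.ball_mem_nhds z one_pos] with x hx
    refine ae_of_all _ (hle x ?_)
    have := norm_sub_norm_le x z
    rw [Metric.mem_ball, dist_eq_norm] at hx
    linarith
  · filter_upwards [(Measure.measurePreserving_sub_left volume z).quasiMeasurePreserving.ae hcont] with w hw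
    exact continuousAt_const.mul
      (ContinuousAt.comp (f := fun x : ℂ => x - w) hw (continuousAt_id.sub continuousAt_const))

end BddCompact

lemma differentiableAt_cauchyTransform {g : ℂ → ℂ} (hg : Integrable g) {z : ℂ} {δ : ℝ}
    (hδ : 0 < δ) (hz : ∀ y, g y ≠ 0 → δ ≤ ‖z - y‖) :
    DifferentiableAt ℂ (cauchyTransform g) z := by
  rw [funext (cauchyTransform_eq g)]
  have hfar : ∀ y, ∀ x ∈ Metric.ball z (δ / 2), g y ≠ 0 → δ / 2 ≤ ‖x - y‖ := by
    intro y x hx h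
    have h1 := hz y h
    have h2 : ‖z - y‖ ≤ ‖x - y‖ + ‖x - z‖ := by
      rw [norm_sub_rev x z, add_comm]; simpa using norm_add_le (z - x) (x - y)
    rw [Metric.mem_ball, dist_eq_norm] at hx
    linarith
  have hmeas : ∀ x, AEStronglyMeasurable (fun y => (x - y)⁻¹ * g y) := fun x =>
    ((measurable_const.sub measurable_id).inv).aestronglyMeasurable.mul hg.aestronglyMeasurable
  refine (hasDerivAt_integral_of_dominated_loc_of_deriv_le
    (F := fun x y => (x - y)⁻¹ * g y) (F' := fun x y => -((x - y) ^ 2)⁻¹ * g y)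
    (bound := fun y => ((δ / 2) ^ 2)⁻¹ * ‖g y‖)
    (Metric.ball_mem_nhds z (half_pos hδ)) (.of_forall hmeas) ?_ ?_ ?_
    (hg.norm.const_mul _) ?_).2.differentiableAt
  · refine (hg.norm.const_mul δ⁻¹).mono' (hmeas z) (ae_of_all _ fun y => ?_)
    by_cases h : g y = 0
    · simp [h]
    · rw [norm_mul, norm_inv]
      gcongr
      exact hz y h
  · exact (((measurable_const.sub measurable_id).pow_const 2).inv.neg).aestronglyMeasurable.mul
      hg.aestronglyMeasurable
  · refine ae_of_all _ fun y x hx => ?_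
    by_cases h : g y = 0
    · simp [h]
    · rw [norm_mul, norm_neg, norm_inv, norm_pow]
      gcongr
      exact hfar y x hx h
  · refine ae_of_all _ fun y x hx => ?_
    by_cases h : g y = 0
    · simpa [h] using hasDerivAt_const x (0 : ℂ)
    · have h0 : x - y ≠ 0 := norm_pos_iff.1 ((half_pos hδ).trans_le (hfar y x hx h))
      have := (((hasDerivAt_id x).sub_const y).fun_inv h0).mul_const (g y)
      refine this.congr_deriv ?_
      simp [div_eq_mul_inv]

lemma norm_cauchyTransform_le {g : ℂ → ℂ} (hg : Integrable g) {z : ℂ} {δ : ℝ}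
    (hδ : 0 < δ) (hz : ∀ y, g y ≠ 0 → δ ≤ ‖z - y‖) :
    ‖cauchyTransform g z‖ ≤ δ⁻¹ * ∫ y, ‖g y‖ := by
  rw [cauchyTransform_eq, ← integral_const_mul]
  refine norm_integral_le_of_norm_le (hg.norm.const_mul _) (ae_of_all _ fun y => ?_)
  by_cases h : g y = 0
  · simp [h]
  · rw [norm_mul, norm_inv]
    gcongr
    exact hz y h

/-- Smooth functions all of whose derivatives are bounded. -/
structure SmoothBdd {E F : Type*} [NormedAddCommGroup E] [NormedSpace ℝ E] [NormedAddCommGroup F]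
    [NormedSpace ℝ F] (f : E → F) : Prop where
  contDiff : ContDiff ℝ ∞ f
  bdd : ∀ n, ∃ C, ∀ x, ‖iteratedFDeriv ℝ n f x‖ ≤ C

namespace SmoothBdd

variable {E F G : Type*} [NormedAddCommGroup E] [NormedSpace ℝ E] [NormedAddCommGroup F]
  [NormedSpace ℝ F] [NormedAddCommGroup G] [NormedSpace ℝ G]

lemma fderiv {f : E → F} (hf : SmoothBdd f) : SmoothBdd (fderiv ℝ f) where
  contDiff := hf.contDiff.fderiv_right le_rfl
  bdd n := (hf.bdd (n + 1)).imp fun C h x => by rw [norm_iteratedFDeriv_fderiv]; exact h x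

lemma norm_le {f : E → F} (hf : SmoothBdd f) : ∃ C, ∀ x, ‖f x‖ ≤ C :=
  (hf.bdd 0).imp fun C h x => by simpa using h x

lemma clm_comp {f : E → F} (hf : SmoothBdd f) (L : F →L[ℝ] G) : SmoothBdd (L ∘ f) where
  contDiff := L.contDiff.comp hf.contDiff
  bdd n := by
    obtain ⟨C, hC⟩ := hf.bdd n
    refine ⟨‖L‖ * C, fun x => (L.norm_iteratedFDeriv_comp_left (N := ∞)
      hf.contDiff.contDiffAt (by exact_mod_cast le_top)).trans ?_⟩
    gcongr
    exact hC x

lemma comp_clm {f : F → G} (hf : SmoothBdd f) (L : E →L[ℝ] F) : SmoothBdd (f ∘ L) where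
  contDiff := hf.contDiff.comp L.contDiff
  bdd n := by
    obtain ⟨C, hC⟩ := hf.bdd n
    refine ⟨C * ∏ _i : Fin n, ‖L‖, fun x => ?_⟩
    rw [L.iteratedFDeriv_comp_right hf.contDiff x (by exact_mod_cast le_top)]
    refine (ContinuousMultilinearMap.norm_compContinuousLinearMap_le _ _).trans ?_
    gcongr
    exact hC _

lemma mul {f g : E → ℂ} (hf : SmoothBdd f) (hg : SmoothBdd g) :
    SmoothBdd (fun x => f x * g x) where
  contDiff := hf.contDiff.mul hg.contDiff
  bdd n := by
    choose C hC using hf.bdd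
    choose D hD using hg.bdd
    refine ⟨∑ i ∈ Finset.range (n + 1), (n.choose i : ℝ) * C i * D (n - i), fun x => ?_⟩
    refine (norm_iteratedFDeriv_mul_le hf.contDiff hg.contDiff x (by exact_mod_cast le_top)).trans ?_
    gcongr with i hi
    · exact mul_nonneg (Nat.cast_nonneg _) ((norm_nonneg _).trans (hC i x))
    · exact hC i x
    · exact hD _ x

end SmoothBdd

lemma smoothBdd_cexp_mul_I : SmoothBdd (fun x : ℝ => Complex.exp (x * Complex.I)) where
  contDiff := Complex.contDiff_exp.comp (Complex.ofRealCLM.contDiff.mul contDiff_const)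
  bdd n := by
    refine ⟨1, fun x => ?_⟩
    rw [norm_iteratedFDeriv_eq_norm_iteratedDeriv]
    have : iteratedDeriv n (fun x : ℝ => Complex.exp (x * Complex.I)) =
        fun x : ℝ => Complex.I ^ n * Complex.exp (x * Complex.I) := by
      induction n with
      | zero => simp
      | succ n ih =>
        rw [iteratedDeriv_succ, ih]
        ext x
        have h : HasDerivAt (fun x : ℝ => Complex.exp (x * Complex.I))
            (Complex.exp (x * Complex.I) * (1 * Complex.I)) x :=
          ((Complex.ofRealCLM.hasDerivAt (x := x)).mul_const Complex.I).cexp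
        rw [(h.const_mul _).deriv]
        ring
    rw [this]
    simp [Complex.norm_exp_ofReal_mul_I]

/-- A smooth function which equals `exp (-t)` for `t ≥ 0` and vanishes for `t ≤ -1`. -/
noncomputable def expCutoff (t : ℝ) : ℝ := Real.exp (-t) * Real.smoothTransition (t + 1)

lemma expCutoff_of_nonneg {t : ℝ} (ht : 0 ≤ t) : expCutoff t = Real.exp (-t) := by
  rw [expCutoff, Real.smoothTransition.one_of_one_le (by linarith), mul_one]

lemma expCutoff_of_le {t : ℝ} (ht : t ≤ -1) : expCutoff t = 0 := by
  rw [expCutoff, Real.smoothTransition.zero_of_nonpos (by linarith), mul_zero]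

lemma contDiff_expCutoff : ContDiff ℝ ∞ expCutoff := by
  unfold expCutoff
  exact (Real.contDiff_exp.comp contDiff_neg).mul
    (Real.smoothTransition.contDiff.comp (contDiff_id.add contDiff_const))

lemma smoothBdd_expCutoff : SmoothBdd expCutoff where
  contDiff := contDiff_expCutoff
  bdd n := by
    have hc : Continuous (iteratedDeriv n expCutoff) :=
      contDiff_expCutoff.continuous_iteratedDeriv n (by exact_mod_cast le_top)
    obtain ⟨C, hC⟩ := (isCompact_Icc (a := (-1 : ℝ)) (b := 0)).exists_bound_of_continuousOn
      hc.continuousOn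
    refine ⟨max C 1, fun x => ?_⟩
    rw [norm_iteratedFDeriv_eq_norm_iteratedDeriv]
    rcases lt_or_ge x (-1) with h | h
    · have : expCutoff =ᶠ[nhds x] fun _ => 0 := by
        filter_upwards [Iio_mem_nhds h] with t ht using expCutoff_of_le (le_of_lt ht)
      rw [this.iteratedDeriv_eq]
      simp
    rcases le_or_gt x 0 with h' | h'
    · exact (hC x ⟨h, h'⟩).trans (le_max_left _ _)
    · have : expCutoff =ᶠ[nhds x] fun t => Real.exp ((-1) * t) := by
        filter_upwards [Ioi_mem_nhds h'] with t ht
        rw [expCutoff_of_nonneg (le_of_lt ht), neg_one_mul]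
      rw [this.iteratedDeriv_eq, iteratedDeriv_exp_const_mul]
      refine le_trans ?_ (le_max_right _ _)
      simp [h'.le]

/-- A smooth function with bounded derivatives agreeing with `exp (I z)` for `0 ≤ Im z`. -/
noncomputable def planeWave (z : ℂ) : ℂ := Complex.exp (z.re * Complex.I) * expCutoff z.im

lemma planeWave_of_nonneg {z : ℂ} (hz : 0 ≤ z.im) : planeWave z = Complex.exp (Complex.I * z) := by
  rw [planeWave, expCutoff_of_nonneg hz, Complex.ofReal_exp, ← Complex.exp_add]
  congr 1
  nth_rewrite 3 [← Complex.re_add_im z]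
  push_cast
  linear_combination (-z.im : ℂ) * Complex.I_sq

lemma smoothBdd_planeWave : SmoothBdd planeWave :=
  (smoothBdd_cexp_mul_I.comp_clm Complex.reCLM).mul
    ((smoothBdd_expCutoff.comp_clm Complex.imCLM).clm_comp Complex.ofRealCLM)

lemma contDiff_integral_smul_dilation (n : ℕ) : ∀ {W : Type} [NormedAddCommGroup W]
    [NormedSpace ℝ W] [NormedSpace ℂ W] [SMulCommClass ℝ ℂ W] [IsScalarTower ℝ ℂ W]
    {f : ℂ → W} (_ : SmoothBdd f) {A : ℝ → ℂ} {μ : Measure ℝ}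
    (_ : ∀ k : ℕ, Integrable (fun ξ : ℝ => (ξ : ℂ) ^ k * A ξ) μ),
    ContDiff ℝ n (fun z => ∫ ξ, A ξ • f (ξ • z) ∂μ) := by
  have main : ∀ {W : Type} [NormedAddCommGroup W]
      [NormedSpace ℝ W] [NormedSpace ℂ W] [SMulCommClass ℝ ℂ W] [IsScalarTower ℝ ℂ W]
      {f : ℂ → W} (_ : SmoothBdd f) {A : ℝ → ℂ} {μ : Measure ℝ}
      (_ : ∀ k : ℕ, Integrable (fun ξ : ℝ => (ξ : ℂ) ^ k * A ξ) μ) (z : ℂ),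
      HasFDerivAt (fun z => ∫ ξ, A ξ • f (ξ • z) ∂μ)
        (∫ ξ, ((ξ : ℂ) * A ξ) • fderiv ℝ f (ξ • z) ∂μ) z := by
    intro W _ _ _ _ _ f hf A μ hA z
    obtain ⟨C, hC⟩ := hf.norm_le
    obtain ⟨D, hD⟩ := hf.fderiv.norm_le
    have hA0 : Integrable A μ := by simpa using hA 0
    have hA1 : Integrable (fun ξ : ℝ => (ξ : ℂ) * A ξ) μ := by simpa using hA 1
    have hmeas : ∀ z : ℂ, AEStronglyMeasurable (fun ξ => A ξ • f (ξ • z)) μ := fun z =>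
      hA0.aestronglyMeasurable.smul
        (hf.contDiff.continuous.comp (by fun_prop)).aestronglyMeasurable
    refine hasFDerivAt_integral_of_dominated_of_fderiv_le (𝕜 := ℝ) (s := Set.univ)
      (F' := fun z (ξ : ℝ) => ((ξ : ℂ) * A ξ) • fderiv ℝ f (ξ • z))
      (bound := fun ξ : ℝ => ‖(ξ : ℂ) * A ξ‖ * D) Filter.univ_mem (.of_forall hmeas) ?_ ?_ ?_
      (hA1.norm.mul_const D) ?_
    · refine (hA0.norm.mul_const C).mono' (hmeas z) (ae_of_all _ fun ξ => ?_)
      rw [norm_smul]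
      gcongr
      exact hC _
    · exact hA1.aestronglyMeasurable.smul
        (hf.fderiv.contDiff.continuous.comp (by fun_prop)).aestronglyMeasurable
    · refine ae_of_all _ fun ξ x _ => ?_
      rw [norm_smul]
      gcongr
      exact hD _
    · refine ae_of_all _ fun ξ x _ => ?_
      have h1 : HasFDerivAt (fun z : ℂ => ξ • z) (ξ • ContinuousLinearMap.id ℝ ℂ) x :=
        (hasFDerivAt_id x).const_smul ξ
      have h2 := (((hf.contDiff.differentiable (by simp) (ξ • x)).hasFDerivAt).comp x h1).const_smul
        (A ξ)
      refine h2.congr_fderiv ?_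
      ext v
      simp only [smul_apply, ContinuousLinearMap.comp_apply,
        ContinuousLinearMap.id_apply, map_smul]
      rw [mul_comm, mul_smul]
      exact congrArg _ (algebraMap_smul ℂ ξ _).symm
  induction n with
  | zero =>
    intro W _ _ _ _ _ f hf A μ hA
    exact contDiff_zero.2 (continuous_iff_continuousAt.2 fun z => (main hf hA z).continuousAt)
  | succ n ih =>
    intro W _ _ _ _ _ f hf A μ hA
    refine contDiff_succ_iff_hasFDerivAt.2 ⟨_, ih hf.fderiv (A := fun ξ => (ξ : ℂ) * A ξ) ?_, main hf hA⟩
    intro k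
    simpa [pow_succ, mul_assoc] using hA (k + 1)

/-- The closed lower half-plane. -/
def lowerHalf : Set ℂ := {y | y.im ≤ 0}

lemma measurableSet_lowerHalf : MeasurableSet lowerHalf :=
  (isClosed_le Complex.continuous_im continuous_const).measurableSet

/-- The Fourier-Laplace transform of `h` over the lower half-plane. -/
noncomputable def halfFourier (h : ℂ → ℂ) (ξ : ℝ) : ℂ :=
  ∫ y, lowerHalf.indicator h y * Complex.exp (-Complex.I * ξ * y)

section HalfFourier

variable {h : ℂ → ℂ}

lemma integrable_halfFourier (hh : Continuous h) (hc : HasCompactSupport h) (ξ : ℝ) :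
    Integrable fun y => lowerHalf.indicator h y * Complex.exp (-Complex.I * ξ * y) := by
  have h1 : Integrable fun y => h y * Complex.exp (-Complex.I * ξ * y) :=
    (hh.mul (by fun_prop)).integrable_of_hasCompactSupport hc.mul_right
  refine (h1.indicator measurableSet_lowerHalf).congr (ae_of_all _ fun y => ?_)
  by_cases hy : y ∈ lowerHalf <;> simp [hy]

lemma norm_exp_lowerHalf_le {ξ : ℝ} (hξ : 0 ≤ ξ) {y : ℂ} (hy : y ∈ lowerHalf) :
    ‖Complex.exp (-Complex.I * ξ * y)‖ ≤ 1 := by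
  rw [Complex.norm_exp, Real.exp_le_one_iff]
  simpa using mul_nonpos_of_nonneg_of_nonpos hξ hy

lemma norm_halfFourier_le (hh : Continuous h) (hc : HasCompactSupport h) {ξ : ℝ} (hξ : 0 ≤ ξ) :
    ‖halfFourier h ξ‖ ≤ ∫ y, ‖h y‖ := by
  refine norm_integral_le_of_norm_le (hh.integrable_of_hasCompactSupport hc).norm
    (ae_of_all _ fun y => ?_)
  by_cases hy : y ∈ lowerHalf
  · rw [Set.indicator_of_mem hy, norm_mul]
    exact mul_le_of_le_one_right (norm_nonneg _) (norm_exp_lowerHalf_le hξ hy)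
  · simp [hy]

lemma mul_halfFourier (hh : ContDiff ℝ ∞ h) (hc : HasCompactSupport h) (ξ : ℝ) :
    (ξ : ℂ) * halfFourier h ξ = -Complex.I * halfFourier (fun y => fderiv ℝ h y 1) ξ := by
  have hd : Continuous (fun y => fderiv ℝ h y 1) :=
    (hh.continuous_fderiv (by simp)).clm_apply continuous_const
  have hdc : HasCompactSupport (fun y => fderiv ℝ h y 1) := hc.fderiv_apply ℝ 1
  have key := integral_bilinear_hasLineDerivAt_right_eq_neg_left_of_integrable (μ := volume)
    (f := lowerHalf.indicator h) (f' := lowerHalf.indicator (fun y => fderiv ℝ h y 1))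
    (g := fun y : ℂ => Complex.exp (-Complex.I * ξ * y))
    (g' := fun y : ℂ => Complex.exp (-Complex.I * ξ * y) * (-Complex.I * ξ))
    (v := (1 : ℂ)) (B := ContinuousLinearMap.mul ℝ ℂ)
    (integrable_halfFourier hd hdc ξ)
    (by simpa [mul_assoc] using (integrable_halfFourier hh.continuous hc ξ).mul_const (-Complex.I * ξ))
    (integrable_halfFourier hh.continuous hc ξ) ?_ ?_
  · simp only [ContinuousLinearMap.mul_apply', ← mul_assoc, integral_mul_const] at key
    change halfFourier h ξ * _ * _ = - halfFourier _ ξ at key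
    linear_combination Complex.I * key + ξ * halfFourier h ξ * Complex.I_sq
  · intro y _
    have hl : HasLineDerivAt ℝ h (fderiv ℝ h y 1) y 1 :=
      (hh.differentiable (by simp) y).hasFDerivAt.hasLineDerivAt 1
    have hmem : ∀ t : ℝ, y + t • (1 : ℂ) ∈ lowerHalf ↔ y ∈ lowerHalf := by
      intro t; simp [lowerHalf]
    unfold HasLineDerivAt at hl ⊢
    by_cases hy : y ∈ lowerHalf
    · simpa only [Set.indicator, hmem, hy, if_true] using hl
    · simpa only [Set.indicator, hmem, hy, if_false] using hasDerivAt_const (0 : ℝ) (0 : ℂ)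
  · intro y _
    have h1 : HasDerivAt (fun y : ℂ => Complex.exp (-Complex.I * ξ * y))
        (Complex.exp (-Complex.I * ξ * y) * (-Complex.I * ξ * 1)) y :=
      ((hasDerivAt_id y).const_mul _).cexp
    have h2 := (h1.hasFDerivAt.restrictScalars ℝ).hasLineDerivAt 1
    simpa using h2

lemma exists_pow_mul_halfFourier_le (k : ℕ) : ∀ {h : ℂ → ℂ} (_ : ContDiff ℝ ∞ h)
    (_ : HasCompactSupport h), ∃ M, ∀ ξ : ℝ, 0 ≤ ξ → ‖(ξ : ℂ) ^ k * halfFourier h ξ‖ ≤ M := by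
  induction k with
  | zero =>
    intro h hh hc
    exact ⟨_, fun ξ hξ => by simpa using norm_halfFourier_le hh.continuous hc hξ⟩
  | succ k ih =>
    intro h hh hc
    have hd : ContDiff ℝ ∞ (fun y => fderiv ℝ h y 1) :=
      (hh.fderiv_right (m := ∞) le_rfl).clm_apply contDiff_const
    obtain ⟨M, hM⟩ := ih hd (hc.fderiv_apply ℝ 1)
    refine ⟨M, fun ξ hξ => le_trans (le_of_eq ?_) (hM ξ hξ)⟩
    rw [pow_succ, mul_assoc, mul_halfFourier hh hc]
    simp

lemma stronglyMeasurable_halfFourier (hh : Continuous h) : StronglyMeasurable (halfFourier h) := by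
  refine StronglyMeasurable.integral_prod_right
    (f := fun ξ y => lowerHalf.indicator h y * Complex.exp (-Complex.I * (ξ : ℝ) * y)) ?_
  refine Measurable.stronglyMeasurable (Measurable.mul ?_ ?_)
  · exact (hh.measurable.indicator measurableSet_lowerHalf).comp measurable_snd
  · exact (by fun_prop : Continuous fun p : ℝ × ℂ => Complex.exp (-Complex.I * p.1 * p.2)).measurable

lemma integrable_pow_mul_halfFourier (hh : ContDiff ℝ ∞ h) (hc : HasCompactSupport h) (k : ℕ) :
    Integrable (fun ξ : ℝ => (ξ : ℂ) ^ k * halfFourier h ξ) (volume.restrict (Set.Ioi 0)) := by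
  obtain ⟨M, hM⟩ := exists_pow_mul_halfFourier_le k hh hc
  obtain ⟨N, hN⟩ := exists_pow_mul_halfFourier_le (k + 2) hh hc
  refine ((integrable_inv_one_add_sq.const_mul (M + N)).integrableOn (s := Set.Ioi 0)).mono' ?_ ?_
  · exact ((by fun_prop : Continuous fun ξ : ℝ => (ξ : ℂ) ^ k).stronglyMeasurable.mul
      (stronglyMeasurable_halfFourier hh.continuous)).aestronglyMeasurable
  · filter_upwards [ae_restrict_mem measurableSet_Ioi] with ξ hξ
    have h1 := hM ξ (le_of_lt hξ)
    have h2 := hN ξ (le_of_lt hξ)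
    have h3 : ‖(ξ : ℂ) ^ (k + 2) * halfFourier h ξ‖ = ξ ^ 2 * ‖(ξ : ℂ) ^ k * halfFourier h ξ‖ := by
      simp only [norm_mul, norm_pow, Complex.norm_real, pow_add, Real.norm_eq_abs, sq_abs]
      ring
    rw [← div_eq_mul_inv, le_div_iff₀ (by positivity)]
    linarith

/-- The smooth extension to the plane of the Cauchy transform of `h` over the lower half-plane. -/
noncomputable def cauchyExtension (h : ℂ → ℂ) (z : ℂ) : ℂ :=
  -Complex.I * ∫ ξ in Set.Ioi (0 : ℝ), halfFourier h ξ • planeWave (ξ • z)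

lemma contDiff_cauchyExtension (hh : ContDiff ℝ ∞ h) (hc : HasCompactSupport h) :
    ContDiff ℝ ∞ (cauchyExtension h) :=
  contDiff_const.mul (contDiff_infty.2 fun n => contDiff_integral_smul_dilation n
    smoothBdd_planeWave (integrable_pow_mul_halfFourier hh hc))

lemma cauchyExtension_eq (hh : Continuous h) (hc : HasCompactSupport h) {z : ℂ} (hz : 0 < z.im) :
    cauchyExtension h z = cauchyTransform (lowerHalf.indicator h) z := by
  have hinteg : Integrable (lowerHalf.indicator h) :=
    (hh.integrable_of_hasCompactSupport hc).indicator measurableSet_lowerHalf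
  have hprod : Integrable (Function.uncurry fun (y : ℂ) (ξ : ℝ) =>
      lowerHalf.indicator h y * Complex.exp (Complex.I * (z - y) * ξ))
      (volume.prod (volume.restrict (Set.Ioi 0))) := by
    have hexp : Integrable (fun ξ : ℝ => Real.exp (-z.im * ξ)) (volume.restrict (Set.Ioi 0)) :=
      integrableOn_exp_mul_Ioi (neg_lt_zero.2 hz) 0
    refine (hinteg.norm.mul_prod hexp).mono' ?_ ?_
    · exact (hinteg.aestronglyMeasurable.comp_fst).mul
        (by fun_prop : Continuous fun p : ℂ × ℝ =>
          Complex.exp (Complex.I * (z - p.1) * p.2)).aestronglyMeasurable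
    · filter_upwards [Measure.quasiMeasurePreserving_snd.ae (ae_restrict_mem measurableSet_Ioi)]
      rintro ⟨y, ξ⟩ hξ
      have hξ : 0 < ξ := hξ
      by_cases hy : y ∈ lowerHalf
      · simp only [Function.uncurry, norm_mul]
        gcongr
        rw [Complex.norm_exp]
        gcongr
        have : y.im ≤ 0 := hy
        simp
        nlinarith
      · simp [Function.uncurry, hy]
  rw [cauchyTransform_eq]
  have h1 : ∀ y, (z - y)⁻¹ * lowerHalf.indicator h y = -Complex.I * ∫ ξ in Set.Ioi (0 : ℝ),
      lowerHalf.indicator h y * Complex.exp (Complex.I * (z - y) * ξ) := by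
    intro y
    by_cases hy : y ∈ lowerHalf
    · have hy' : y.im ≤ 0 := hy
      have hne : z - y ≠ 0 := fun h0 => by
        have := congrArg Complex.im h0
        simp at this
        linarith
      rw [integral_const_mul, integral_exp_mul_complex_Ioi (by simp; linarith)]
      simp
      field_simp
    · simp [hy]
  simp_rw [h1]
  rw [integral_const_mul, integral_integral_swap hprod, cauchyExtension]
  congr 1
  refine setIntegral_congr_fun measurableSet_Ioi fun ξ hξ => ?_
  have hξ : 0 < ξ := hξ
  simp only [smul_eq_mul]
  rw [planeWave_of_nonneg (by simpa using (mul_pos hξ hz).le), halfFourier, ← integral_mul_const]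
  congr 1
  ext y
  rw [mul_assoc, ← Complex.exp_add]
  congr 2
  rw [Complex.real_smul]
  ring

end HalfFourier

/-- The even reflection `f + conj ∘ f ∘ conj`. -/
noncomputable def evenReflection (f : ℂ → ℂ) (y : ℂ) : ℂ :=
  f y + starRingEnd ℂ (f (starRingEnd ℂ y))

/-- The restriction of `f` to the upper half-plane, extended oddly to the lower half-plane. -/
noncomputable def oddReflection (f : ℂ → ℂ) (y : ℂ) : ℂ :=
  {y : ℂ | 0 < y.im}.indicator f y -
    starRingEnd ℂ ({y : ℂ | 0 < y.im}.indicator f (starRingEnd ℂ y))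

/-- A smooth function on the plane whose real part is, up to the factor `2π`, the Dirichlet
potential of the vector field `f` in the upper half-plane. -/
noncomputable def hodgePotential (f : ℂ → ℂ) (z : ℂ) : ℂ :=
  cauchyTransform f z - cauchyExtension (evenReflection f) z

lemma ae_im_ne_zero : ∀ᵐ y : ℂ, y.im ≠ 0 := by
  have h := Measure.addHaar_submodule (volume : Measure ℂ) (LinearMap.ker Complex.imLm) (by
    intro h
    have : Complex.I ∈ LinearMap.ker Complex.imLm := h ▸ Submodule.mem_top
    simp at this)
  rw [ae_iff]
  convert h using 2
  ext y
  simp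

lemma measurableSet_im_pos : MeasurableSet {y : ℂ | 0 < y.im} :=
  (isOpen_lt continuous_const Complex.continuous_im).measurableSet

section HodgePotential

variable {f : ℂ → ℂ}

lemma contDiff_evenReflection (hf : ContDiff ℝ ∞ f) : ContDiff ℝ ∞ (evenReflection f) :=
  hf.add (Complex.conjCLE.contDiff.comp (hf.comp Complex.conjCLE.contDiff))

lemma hasCompactSupport_evenReflection (hc : HasCompactSupport f) :
    HasCompactSupport (evenReflection f) := by
  refine hc.add (HasCompactSupport.comp_left (g := starRingEnd ℂ) ?_ (map_zero _))
  exact hc.comp_homeomorph Complex.conjCLE.toHomeomorph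

lemma BddCompact.oddReflection (hf : BddCompact f) : BddCompact (oddReflection f) := by
  have h := hf.indicator measurableSet_im_pos
  have h' := h.conj_reflect
  refine ⟨h.measurable.sub h'.measurable, ?_, ?_⟩
  · obtain ⟨M, hM⟩ := h.bdd
    obtain ⟨M', hM'⟩ := h'.bdd
    exact ⟨M + M', fun y => (norm_sub_le _ _).trans (add_le_add (hM y) (hM' y))⟩
  · obtain ⟨R, hR⟩ := h.supp
    obtain ⟨R', hR'⟩ := h'.supp
    refine ⟨max R R', fun y hy => ?_⟩
    have h1 := hR y ((le_max_left _ _).trans_lt hy)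
    have h2 := hR' y ((le_max_right _ _).trans_lt hy)
    simp only [_root_.oddReflection, h1, h2, sub_zero]

lemma oddReflection_of_im_pos {y : ℂ} (hy : 0 < y.im) : oddReflection f y = f y := by
  simp [oddReflection, hy, hy.le]

lemma oddReflection_conj (y : ℂ) :
    oddReflection f (starRingEnd ℂ y) = -starRingEnd ℂ (oddReflection f y) := by
  simp [oddReflection]

lemma oddReflection_ae_eq :
    oddReflection f =ᵐ[volume] fun y => f y - lowerHalf.indicator (evenReflection f) y := by
  filter_upwards [ae_im_ne_zero] with y hy
  rcases lt_or_gt_of_ne hy with h | h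
  · simp [oddReflection, lowerHalf, evenReflection, h.le, h, h.not_gt]
  · simp [oddReflection, lowerHalf, h, h.le]

lemma cauchyTransform_oddReflection (hf : Continuous f) (hc : HasCompactSupport f)
    (hs : BddCompact (lowerHalf.indicator (evenReflection f))) (z : ℂ) :
    cauchyTransform (oddReflection f) z =
      cauchyTransform f z - cauchyTransform (lowerHalf.indicator (evenReflection f)) z := by
  rw [← (BddCompact.of_continuous hf hc).cauchyTransform_sub hs, cauchyTransform_eq,
    cauchyTransform_eq]
  refine integral_congr_ae ?_
  filter_upwards [oddReflection_ae_eq (f := f)] with y hy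
  rw [hy]

lemma cauchyTransform_oddReflection_re (x : ℂ) (hx : x.im = 0) :
    (cauchyTransform (oddReflection f) x).re = 0 := by
  have hxc : starRingEnd ℂ x = x := Complex.conj_eq_iff_im.2 hx
  have h : cauchyTransform (oddReflection f) x =
      -starRingEnd ℂ (cauchyTransform (oddReflection f) x) := by
    rw [cauchyTransform_eq, ← integral_conj, ← integral_neg,
      ← (Complex.conjLIE.measurePreserving).integral_comp
        Complex.conjLIE.toHomeomorph.measurableEmbedding]
    refine integral_congr_ae (ae_of_all _ fun y => ?_)
    simp [oddReflection_conj, hxc]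
  have := congrArg Complex.re h
  simp only [Complex.neg_re, Complex.conj_re] at this
  linarith

lemma bddCompact_indicator_evenReflection (hf : ContDiff ℝ ∞ f) (hc : HasCompactSupport f) :
    BddCompact (lowerHalf.indicator (evenReflection f)) :=
  (BddCompact.of_continuous (contDiff_evenReflection hf).continuous
    (hasCompactSupport_evenReflection hc)).indicator measurableSet_lowerHalf

lemma contDiff_hodgePotential (hf : ContDiff ℝ ∞ f) (hc : HasCompactSupport f) :
    ContDiff ℝ ∞ (hodgePotential f) :=
  (contDiff_cauchyTransform hf hc).sub
    (contDiff_cauchyExtension (contDiff_evenReflection hf) (hasCompactSupport_evenReflection hc))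

lemma hodgePotential_eq (hf : ContDiff ℝ ∞ f) (hc : HasCompactSupport f)
    {z : ℂ} (hz : 0 < z.im) :
    hodgePotential f z = cauchyTransform (oddReflection f) z := by
  rw [cauchyTransform_oddReflection hf.continuous hc (bddCompact_indicator_evenReflection hf hc),
    hodgePotential, cauchyExtension_eq (contDiff_evenReflection hf).continuous
      (hasCompactSupport_evenReflection hc) hz]

lemma continuous_cauchyTransform_oddReflection (hf : ContDiff ℝ ∞ f) (hc : HasCompactSupport f) :
    Continuous (cauchyTransform (oddReflection f)) := by
  have hs := bddCompact_indicator_evenReflection hf hc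
  rw [funext (cauchyTransform_oddReflection hf.continuous hc hs)]
  refine (contDiff_cauchyTransform hf hc).continuous.sub (hs.continuous_cauchyTransform ?_)
  filter_upwards [ae_im_ne_zero] with y hy
  rcases lt_or_gt_of_ne hy with h | h
  · refine (contDiff_evenReflection hf).continuous.continuousAt.congr ?_
    filter_upwards [(isOpen_lt Complex.continuous_im continuous_const).mem_nhds h] with w hw
    exact (Set.indicator_of_mem (s := lowerHalf) (le_of_lt hw) _).symm
  · refine (continuousAt_const (y := (0 : ℂ))).congr ?_
    filter_upwards [(isOpen_lt continuous_const Complex.continuous_im).mem_nhds h] with w hw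
    exact (Set.indicator_of_notMem (s := lowerHalf) (not_le_of_gt hw) _).symm

lemma hodgePotential_re_eq_zero (hf : ContDiff ℝ ∞ f) (hc : HasCompactSupport f)
    {x : ℂ} (hx : x.im = 0) : (hodgePotential f x).re = 0 := by
  have h : Set.EqOn (hodgePotential f) (cauchyTransform (oddReflection f))
      (closure {z : ℂ | 0 < z.im}) :=
    Set.EqOn.closure (fun z hz => hodgePotential_eq hf hc hz)
      (contDiff_hodgePotential hf hc).continuous (continuous_cauchyTransform_oddReflection hf hc)
  rw [h (by rw [Complex.closure_setOfPred_lt_im]; exact hx.ge), cauchyTransform_oddReflection_re x hx]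

lemma dbar_hodgePotential (hf : ContDiff ℝ ∞ f) (hc : HasCompactSupport f)
    {z : ℂ} (hz : 0 < z.im) :
    fderiv ℝ (hodgePotential f) z 1 + Complex.I * fderiv ℝ (hodgePotential f) z Complex.I =
      2 * Real.pi * f z := by
  have hs := bddCompact_indicator_evenReflection hf hc
  have hd : DifferentiableAt ℂ (cauchyExtension (evenReflection f)) z := by
    refine (differentiableAt_cauchyTransform hs.integrable hz fun y hy => ?_).congr_of_eventuallyEq
      (f₁ := cauchyExtension (evenReflection f)) ?_
    · have : y.im ≤ 0 := Set.mem_of_indicator_ne_zero (s := lowerHalf) hy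
      have h := (le_abs_self _).trans (Complex.abs_im_le_norm (z - y))
      rw [Complex.sub_im] at h
      linarith
    · filter_upwards [(isOpen_lt continuous_const Complex.continuous_im).mem_nhds hz] with w hw
      exact cauchyExtension_eq (contDiff_evenReflection hf).continuous
        (hasCompactSupport_evenReflection hc) hw
  have hdiff : Differentiable ℝ (cauchyTransform f) :=
    (contDiff_cauchyTransform hf hc).differentiable (by simp)
  have h : fderiv ℝ (hodgePotential f) z = fderiv ℝ (cauchyTransform f) z -
      fderiv ℝ (cauchyExtension (evenReflection f)) z :=
    fderiv_sub hdiff.differentiableAt (hd.restrictScalars ℝ)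
  rw [h, hd.fderiv_restrictScalars ℝ, ← dbar_cauchyTransform hf hc z]
  have hI := (fderiv ℂ (cauchyExtension (evenReflection f)) z).map_smul Complex.I 1
  simp only [smul_eq_mul, mul_one] at hI
  simp only [sub_apply, ContinuousLinearMap.coe_restrictScalars', hI]
  linear_combination -fderiv ℂ (cauchyExtension (evenReflection f)) z 1 * Complex.I_sq

end HodgePotential

section Localization

variable {E : Type*} [NormedAddCommGroup E] [NormedSpace ℝ E]

lemma norm_iteratedFDeriv_comp_clm_le (e : E →L[ℝ] ℂ) {U : Set ℂ} (hU : IsOpen U) (k : ℕ) :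
    ∀ {g : ℂ → ℂ} (_ : DifferentiableOn ℂ g U) {p : E} (_ : e p ∈ U),
      ‖iteratedFDeriv ℝ k (g ∘ e) p‖ ≤ ‖e‖ ^ k * ‖iteratedDeriv k g (e p)‖ := by
  induction k with
  | zero => intro g _ p _; simp
  | succ k ih =>
    intro g hg p hp
    have hg' : DifferentiableOn ℂ (deriv g) U := hg.deriv hU
    let L : ℂ →L[ℝ] E →L[ℝ] ℂ :=
      ((ContinuousLinearMap.compL ℝ E ℂ ℂ).flip e).comp (ContinuousLinearMap.mul ℝ ℂ)
    have hL : ‖L‖ ≤ ‖e‖ := by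
      refine L.opNorm_le_bound (norm_nonneg _) fun c => ?_
      calc ‖L c‖ ≤ ‖ContinuousLinearMap.mul ℝ ℂ c‖ * ‖e‖ :=
            ContinuousLinearMap.opNorm_comp_le _ _
        _ ≤ ‖e‖ * ‖c‖ := by
            rw [mul_comm]
            gcongr
            exact ContinuousLinearMap.opNorm_mul_apply_le ℝ ℂ c
    have heq : fderiv ℝ (g ∘ e) =ᶠ[nhds p] L ∘ (deriv g ∘ e) := by
      filter_upwards [(hU.preimage e.continuous).mem_nhds hp] with q hq
      have hd := (hg.differentiableAt (hU.mem_nhds hq)).hasDerivAt.hasFDerivAt.restrictScalars ℝ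
      rw [(hd.comp q e.hasFDerivAt).fderiv]
      ext v
      simp [L, mul_comm]
    have hcd : ContDiffAt ℝ k (deriv g ∘ e) p := by
      have h : ContDiffAt ℂ k (deriv g) (e p) :=
        (hg'.contDiffOn hU).contDiffAt (hU.mem_nhds hp)
      exact (h.restrict_scalars ℝ).comp p e.contDiff.contDiffAt
    rw [← norm_iteratedFDeriv_fderiv, heq.iteratedFDeriv ℝ k |>.eq_of_nhds, pow_succ',
      iteratedDeriv_succ']
    calc _ ≤ ‖L‖ * ‖iteratedFDeriv ℝ k (deriv g ∘ e) p‖ :=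
          L.norm_iteratedFDeriv_comp_left hcd le_rfl
      _ ≤ ‖e‖ * (‖e‖ ^ k * ‖iteratedDeriv k (deriv g) (e p)‖) := by
          gcongr
          exact ih hg' hp
      _ = _ := by ring

end Localization

section HodgePotentialBounds

variable {f : ℂ → ℂ}

lemma le_norm_sub_of_oddReflection_ne_zero {z y : ℂ} {Λ : ℝ} (hz : 0 < z.im)
    (hfar : ∀ w, f w ≠ 0 → Λ ≤ ‖z - w‖) (hy : oddReflection f y ≠ 0) : Λ ≤ ‖z - y‖ := by
  rcases lt_trichotomy y.im 0 with h | h | h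
  · have h' : 0 < (starRingEnd ℂ y).im := by simpa using h
    have hne : f (starRingEnd ℂ y) ≠ 0 := by
      rw [← oddReflection_of_im_pos (f := f) h', oddReflection_conj]
      simpa using hy
    refine (hfar _ hne).trans ?_
    rw [← sq_le_sq₀ (norm_nonneg _) (norm_nonneg _), ← Complex.normSq_eq_norm_sq,
      ← Complex.normSq_eq_norm_sq, Complex.normSq_apply, Complex.normSq_apply]
    simp only [Complex.sub_re, Complex.conj_re, Complex.sub_im, Complex.conj_im]
    nlinarith
  · exact absurd (by simp [oddReflection, h]) hy
  · exact hfar _ (by rwa [oddReflection_of_im_pos h] at hy)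

lemma integral_norm_oddReflection_le (hf : BddCompact f) :
    ∫ y, ‖oddReflection f y‖ ≤ 2 * ∫ y in {y : ℂ | 0 < y.im}, ‖f y‖ := by
  have h := (hf.indicator measurableSet_im_pos)
  have h1 := h.integrable.norm
  have h2 := h.conj_reflect.integrable.norm
  calc ∫ y, ‖oddReflection f y‖
      ≤ ∫ y, (‖{y : ℂ | 0 < y.im}.indicator f y‖ +
          ‖starRingEnd ℂ ({y : ℂ | 0 < y.im}.indicator f (starRingEnd ℂ y))‖) :=
        integral_mono hf.oddReflection.integrable.norm (h1.add h2) fun y => norm_sub_le _ _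
    _ = (∫ y, ‖{y : ℂ | 0 < y.im}.indicator f y‖) +
          ∫ y, ‖{y : ℂ | 0 < y.im}.indicator f (Complex.conjLIE y)‖ := by
        rw [integral_add h1 h2]
        simp
    _ = _ := by
        rw [Complex.conjLIE.measurePreserving.integral_comp
          Complex.conjLIE.toHomeomorph.measurableEmbedding
          (fun y => ‖{y : ℂ | 0 < y.im}.indicator f y‖), ← two_mul]
        simp_rw [norm_indicator_eq_indicator_norm]
        rw [integral_indicator measurableSet_im_pos]

lemma norm_iteratedFDeriv_hodgePotential_le (hf : ContDiff ℝ ∞ f) (hc : HasCompactSupport f)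
    {E : Type*} [NormedAddCommGroup E] [NormedSpace ℝ E] (e : E →L[ℝ] ℂ) (k : ℕ) {p : E} {Λ : ℝ}
    (hΛ : 0 < Λ) (hp : 0 < (e p).im) (hfar : ∀ w, f w ≠ 0 → Λ ≤ ‖e p - w‖) :
    ‖iteratedFDeriv ℝ k (hodgePotential f ∘ e) p‖ ≤
      ‖e‖ ^ k * (k.factorial * ((Λ / 2)⁻¹ * (2 * ∫ y in {y : ℂ | 0 < y.im}, ‖f y‖)) /
        (Λ / 2) ^ k) := by
  have hb := BddCompact.of_continuous hf.continuous hc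
  have hodd := hb.oddReflection.integrable
  have hdist : ∀ z y, oddReflection f y ≠ 0 → Λ - ‖z - e p‖ ≤ ‖z - y‖ := by
    intro z y hy
    have h1 := le_norm_sub_of_oddReflection_ne_zero hp hfar hy
    have h2 := norm_sub_le_norm_sub_add_norm_sub (e p) z y
    rw [norm_sub_rev (e p) z] at h2
    linarith
  have hd : DifferentiableOn ℂ (cauchyTransform (oddReflection f)) (Metric.ball (e p) Λ) := by
    intro z hz
    rw [Metric.mem_ball, dist_eq_norm] at hz
    exact (differentiableAt_cauchyTransform hodd (sub_pos.2 hz)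
      (hdist z)).differentiableWithinAt
  have heq : hodgePotential f ∘ e =ᶠ[nhds p] cauchyTransform (oddReflection f) ∘ e := by
    filter_upwards [((isOpen_lt continuous_const Complex.continuous_im).preimage
      e.continuous).mem_nhds hp] with q hq
    exact hodgePotential_eq hf hc hq
  rw [heq.iteratedFDeriv ℝ k |>.eq_of_nhds]
  refine (norm_iteratedFDeriv_comp_clm_le e Metric.isOpen_ball k hd
    (Metric.mem_ball_self hΛ)).trans ?_
  gcongr
  have hlt : Metric.closedBall (e p) (Λ / 2) ⊆ Metric.ball (e p) Λ :=
    Metric.closedBall_subset_ball (half_lt_self hΛ)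
  refine Complex.norm_iteratedDeriv_le_of_forall_mem_sphere_norm_le k (half_pos hΛ)
    (hd.diffContOnCl_ball hlt) fun z hz => ?_
  refine (norm_cauchyTransform_le hodd (half_pos hΛ) fun y hy => ?_).trans ?_
  · have := hdist z y hy
    rw [mem_sphere_iff_norm] at hz
    linarith
  · gcongr
    exact integral_norm_oddReflection_le hb

end HodgePotentialBounds

section HalfPlane

/-- The identification of `ℝ × ℝ` with `ℂ`. -/
noncomputable def toComplex : (ℝ × ℝ) ≃L[ℝ] ℂ := Complex.equivRealProdCLM.symm

lemma toComplex_re (x : ℝ × ℝ) : (toComplex x).re = x.1 := rfl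

lemma toComplex_im (x : ℝ × ℝ) : (toComplex x).im = x.2 := rfl

lemma dist_le_norm_toComplex_sub (x y : ℝ × ℝ) : dist x y ≤ ‖toComplex x - toComplex y‖ := by
  rw [← map_sub, dist_eq_norm, Prod.norm_def]
  exact max_le (Complex.abs_re_le_norm (toComplex (x - y)))
    (Complex.abs_im_le_norm (toComplex (x - y)))

/-- A planar vector field as a complex function. -/
noncomputable def complexField (F : ℝ × ℝ → ℝ × ℝ) : ℂ → ℂ := toComplex ∘ F ∘ toComplex.symm

variable {F : ℝ × ℝ → ℝ × ℝ}

lemma contDiff_complexField (hF : ContDiff ℝ ∞ F) : ContDiff ℝ ∞ (complexField F) :=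
  toComplex.contDiff.comp (hF.comp toComplex.symm.contDiff)

lemma hasCompactSupport_complexField (hc : HasCompactSupport F) :
    HasCompactSupport (complexField F) :=
  HasCompactSupport.comp_left (g := toComplex)
    (hc.comp_homeomorph toComplex.symm.toHomeomorph) (map_zero _)

lemma integral_norm_complexField_le (hF : Continuous F) (hc : HasCompactSupport F) :
    ∫ y in {y : ℂ | 0 < y.im}, ‖complexField F y‖ ≤
      ‖(toComplex : (ℝ × ℝ) →L[ℝ] ℂ)‖ * ∫ z in upperHalf, ‖F z‖ := by
  have h := Complex.volume_preserving_equiv_real_prod.setIntegral_preimage_emb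
    Complex.measurableEquivRealProd.measurableEmbedding (fun w => ‖toComplex (F w)‖) upperHalf
  change ∫ y in {y : ℂ | 0 < y.im}, ‖complexField F y‖ = _ at h
  rw [h, ← integral_const_mul]
  have hinteg : Integrable F := hF.integrable_of_hasCompactSupport hc
  refine integral_mono ?_ (hinteg.norm.integrableOn.const_mul _) fun w =>
    (toComplex : (ℝ × ℝ) →L[ℝ] ℂ).le_opNorm _
  exact ((toComplex : (ℝ × ℝ) →L[ℝ] ℂ).integrable_comp hinteg).norm.integrableOn

/-- The constant in the derivative bounds for `hodgePotential` on `ℝ × ℝ`. -/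
noncomputable def hodgeConst (k : ℕ) : ℝ :=
  ‖(toComplex : (ℝ × ℝ) →L[ℝ] ℂ)‖ ^ (k + 1) * k.factorial * 2 ^ (k + 2)

lemma hodgeConst_nonneg (k : ℕ) : 0 ≤ hodgeConst k := by
  unfold hodgeConst
  positivity

lemma norm_iteratedFDeriv_hodgePotential_complexField_le (hF : ContDiff ℝ ∞ F)
    (hc : HasCompactSupport F) (k : ℕ) {Λ : ℝ} (hΛ : 0 < Λ) {x : ℝ × ℝ} (hx : x ∈ upperHalf)
    (hfar : ∀ y ∈ tsupport F, Λ < dist x y) :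
    ‖iteratedFDeriv ℝ k (hodgePotential (complexField F) ∘ toComplex) x‖ ≤
      hodgeConst k * Λ ^ (-(k : ℝ) - 1) * ∫ z in upperHalf, ‖F z‖ := by
  refine (norm_iteratedFDeriv_hodgePotential_le (contDiff_complexField hF)
    (hasCompactSupport_complexField hc) (toComplex : (ℝ × ℝ) →L[ℝ] ℂ) k hΛ hx ?_).trans ?_
  · intro w hw
    have h : F (toComplex.symm w) ≠ 0 := fun h => hw (by simp [complexField, h])
    have := (hfar _ (subset_tsupport _ h)).le.trans (dist_le_norm_toComplex_sub _ _)
    simpa using this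
  · have hpow : Λ ^ (-(k : ℝ) - 1) = (Λ ^ (k + 1))⁻¹ := by
      rw [← Real.rpow_natCast, ← Real.rpow_neg hΛ.le]
      push_cast
      ring_nf
    calc _ ≤ ‖(toComplex : (ℝ × ℝ) →L[ℝ] ℂ)‖ ^ k * (k.factorial * ((Λ / 2)⁻¹ *
          (2 * (‖(toComplex : (ℝ × ℝ) →L[ℝ] ℂ)‖ * ∫ z in upperHalf, ‖F z‖))) / (Λ / 2) ^ k) := by
          gcongr
          exact integral_norm_complexField_le hF.continuous hc
      _ = _ := by
          rw [hpow, hodgeConst, div_pow]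
          field_simp
          ring

/-- The linear map sending the differential of `U + i V` to `(2π)⁻¹ (-∂₂V, ∂₁V)`. -/
noncomputable def rotGradIm : ((ℝ × ℝ) →L[ℝ] ℂ) →L[ℝ] (ℝ × ℝ) :=
  (2 * Real.pi)⁻¹ •
    ((-(Complex.imCLM.comp (ContinuousLinearMap.apply ℝ ℂ ((0, 1) : ℝ × ℝ)))).prod
      (Complex.imCLM.comp (ContinuousLinearMap.apply ℝ ℂ ((1, 0) : ℝ × ℝ))))

/-- The real part of a complex number divided by `2π`. -/
noncomputable def scaledRe : ℂ →L[ℝ] ℝ := (2 * Real.pi)⁻¹ • Complex.reCLM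

lemma div_rotGradIm_fderiv {g : ℝ × ℝ → ℂ} (hg : ContDiff ℝ ∞ g) (z : ℝ × ℝ) :
    fderiv ℝ (fun w => (rotGradIm (fderiv ℝ g w)).1) z (1, 0) +
      fderiv ℝ (fun w => (rotGradIm (fderiv ℝ g w)).2) z (0, 1) = 0 := by
  have hd : HasFDerivAt (fun w => rotGradIm (fderiv ℝ g w))
      (rotGradIm.comp (fderiv ℝ (fderiv ℝ g) z)) z :=
    rotGradIm.hasFDerivAt.comp z
      ((hg.fderiv_right (m := ∞) le_rfl).differentiable (by simp) z).hasFDerivAt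
  have hsymm : IsSymmSndFDerivAt ℝ g z :=
    hg.contDiffAt.isSymmSndFDerivAt (by
    rw [minSmoothness_of_isRCLikeNormedField]
    exact WithTop.coe_le_coe.2 le_top)
  rw [hd.fst.fderiv, hd.snd.fderiv]
  simp [rotGradIm, hsymm.eq (1, 0) (0, 1)]

lemma eq_grad_add_rotGradIm (hF : ContDiff ℝ ∞ F) (hc : HasCompactSupport F) {z : ℝ × ℝ}
    (hz : z ∈ upperHalf) :
    F z = (fderiv ℝ (scaledRe ∘ hodgePotential (complexField F) ∘ toComplex) z (1, 0),
      fderiv ℝ (scaledRe ∘ hodgePotential (complexField F) ∘ toComplex) z (0, 1)) +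
      rotGradIm (fderiv ℝ (hodgePotential (complexField F) ∘ toComplex) z) := by
  have hΨ := contDiff_hodgePotential (contDiff_complexField hF)
    (hasCompactSupport_complexField hc)
  have hd : HasFDerivAt (hodgePotential (complexField F) ∘ toComplex)
      ((fderiv ℝ (hodgePotential (complexField F)) (toComplex z)).comp
        (toComplex : (ℝ × ℝ) →L[ℝ] ℂ)) z :=
    (hΨ.differentiable (by simp) _).hasFDerivAt.comp z toComplex.hasFDerivAt
  have h1 : toComplex (1, 0) = 1 := by apply Complex.ext <;> rfl
  have hI : toComplex (0, 1) = Complex.I := by apply Complex.ext <;> rfl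
  have hdbar := dbar_hodgePotential (contDiff_complexField hF) (hasCompactSupport_complexField hc)
    (z := toComplex z) hz
  have hre := congrArg Complex.re hdbar
  have him := congrArg Complex.im hdbar
  have hFre : (complexField F (toComplex z)).re = (F z).1 := by simp [complexField, toComplex_re]
  have hFim : (complexField F (toComplex z)).im = (F z).2 := by simp [complexField, toComplex_im]
  rw [(scaledRe.hasFDerivAt.comp z hd).fderiv, hd.fderiv]
  simp [hFre, hFim] at hre him
  have hpi := Real.pi_pos
  ext
  · simp [rotGradIm, scaledRe, h1, hI]
    field_simp
    linarith
  · simp [rotGradIm, scaledRe, h1, hI]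
    field_simp
    linarith

end HalfPlane

end HalfPlaneHodge

/-- Localization estimates for the half-plane Hodge decomposition `F = ∇φ + H`:
away from the support of `F`, `|∇^k φ(x)| ≲ Λ^{−k−1} ‖F‖_{L¹(ℝ²₊)}` and
`|∇^k H(x)| ≲ Λ^{−k−2} ‖F‖_{L¹(ℝ²₊)}`, with constants depending only on `k`. -/
theorem halfplane_hodge_localization :
    ∃ C : ℕ → ℝ, (∀ k, 0 < C k) ∧
      ∀ F : ℝ × ℝ → ℝ × ℝ, ContDiff ℝ (⊤ : ℕ∞) F → HasCompactSupport F →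
        ∃ (φ : ℝ × ℝ → ℝ) (H : ℝ × ℝ → ℝ × ℝ),
          ContDiff ℝ (⊤ : ℕ∞) φ ∧ ContDiff ℝ (⊤ : ℕ∞) H ∧
          (∀ x : ℝ, φ (x, 0) = 0) ∧
          (∀ z ∈ upperHalf,
            fderiv ℝ (fun w => (H w).1) z (1, 0) + fderiv ℝ (fun w => (H w).2) z (0, 1) = 0) ∧
          (∀ z ∈ upperHalf, F z = (fderiv ℝ φ z (1, 0), fderiv ℝ φ z (0, 1)) + H z) ∧
          (∀ k : ℕ, ∀ Λ : ℝ, 0 < Λ → ∀ x : ℝ × ℝ, x ∈ upperHalf →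
            (∀ y ∈ tsupport F, Λ < dist x y) →
            ‖iteratedFDeriv ℝ k φ x‖ ≤
                C k * Λ ^ (-(k : ℝ) - 1) * ∫ z in upperHalf, ‖F z‖ ∧
            ‖iteratedFDeriv ℝ k H x‖ ≤
                C k * Λ ^ (-(k : ℝ) - 2) * ∫ z in upperHalf, ‖F z‖) := by
  refine ⟨fun k => ‖scaledRe‖ * hodgeConst k + ‖rotGradIm‖ * hodgeConst (k + 1) + 1,
    fun k => ?_, fun F hF hc => ?_⟩
  · have := hodgeConst_nonneg k
    have := hodgeConst_nonneg (k + 1)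
    positivity
  have hΨ : ContDiff ℝ (⊤ : ℕ∞) (hodgePotential (complexField F) ∘ toComplex) :=
    (contDiff_hodgePotential (contDiff_complexField hF)
      (hasCompactSupport_complexField hc)).comp toComplex.contDiff
  have hdΨ : ContDiff ℝ (⊤ : ℕ∞) (fderiv ℝ (hodgePotential (complexField F) ∘ toComplex)) :=
    hΨ.fderiv_right le_rfl
  refine ⟨scaledRe ∘ hodgePotential (complexField F) ∘ toComplex,
    rotGradIm ∘ fderiv ℝ (hodgePotential (complexField F) ∘ toComplex),
    scaledRe.contDiff.comp hΨ, rotGradIm.contDiff.comp hdΨ, fun x => ?_,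
    fun z _ => div_rotGradIm_fderiv hΨ z, fun z hz => eq_grad_add_rotGradIm hF hc hz,
    fun k Λ hΛ x hx hfar => ⟨?_, ?_⟩⟩
  · have h := hodgePotential_re_eq_zero (contDiff_complexField hF)
      (hasCompactSupport_complexField hc) (x := toComplex (x, 0)) (toComplex_im _)
    simp [scaledRe, h]
  · have hb := norm_iteratedFDeriv_hodgePotential_complexField_le hF hc k hΛ hx hfar
    refine (scaledRe.norm_iteratedFDeriv_comp_left (n := k) hΨ.contDiffAt
      (by exact_mod_cast le_top)).trans ?_
    refine (mul_le_mul_of_nonneg_left hb (norm_nonneg _)).trans ?_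
    rw [mul_assoc, mul_assoc, ← mul_assoc ‖scaledRe‖]
    gcongr
    have := mul_nonneg (norm_nonneg rotGradIm) (hodgeConst_nonneg (k + 1))
    linarith
  · have hb := norm_iteratedFDeriv_hodgePotential_complexField_le hF hc (k + 1) hΛ hx hfar
    rw [← norm_iteratedFDeriv_fderiv,
      show -((k + 1 : ℕ) : ℝ) - 1 = -(k : ℝ) - 2 by push_cast; ring] at hb
    refine (rotGradIm.norm_iteratedFDeriv_comp_left (n := k) hdΨ.contDiffAt
      (by exact_mod_cast le_top)).trans ?_
    refine (mul_le_mul_of_nonneg_left hb (norm_nonneg _)).trans ?_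
    rw [mul_assoc, mul_assoc, ← mul_assoc ‖rotGradIm‖]
    gcongr
    have := mul_nonneg (norm_nonneg scaledRe) (hodgeConst_nonneg k)
    linarith
end
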